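/- arXiv:math/0201001 — 2 statements merged into one kernel-verified Lean document; each statement's English description precedes it below -/
import Mathlib

section
/- Let (M, τ) be a tracial W*-probability space and D ⊂ M a finite-dimensional unital *-subalgebra. Let A_1, A_2 ⊂ M be unital subalgebras with D ⊂ A_2 (but not necessarily D ⊂ A_1), with A_1 and A_2 algebraically free. If the scalar-valued liberation gradient j_ℂ(A_1:A_2) exists, then the D-valued liberation gradient j_D(A_1∨D : A_2) exists and is given by j_D(A_1∨D : A_2) = E_{D'}( j_ℂ(A_1:A_2) ) · c⁻¹ · dim(D). -/
/-!  Statement 13 (Theorem 5.6):  for finite-dimensional `D ⊆ A₂`, if the scalar-valued liberation gradient `j_ℂ(A₁:A₂)` exists, then the `D`-valued liberation gradient `j_D(A₁∨D : A₂)` exists and equals `E_{D′}(j_ℂ(A₁:A₂)) · c⁻¹ · dim(D)`. -/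

open scoped Classical ENNReal

noncomputable section

namespace OVD

variable {M : Type*} [Ring M] [Algebra ℂ M] [StarRing M] [StarModule ℂ M]

/-- `τ` is a faithful tracial state on the complex `*`-algebra `M`
(the normality and von Neumann algebra structure of a tracial
`W*`-probability space are not used in the algebraic statement). -/
structure IsFaithfulTracialState [StarRing M] (τ : M →ₗ[ℂ] ℂ) : Prop where
  unital : τ 1 = 1
  tracial : ∀ x y, τ (x * y) = τ (y * x)
  pos : ∀ x, 0 ≤ (τ (star x * x)).re ∧ (τ (star x * x)).im = 0
  faithful : ∀ x, τ (star x * x) = 0 → x = 0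

/-- `E : M → M` is a conditional expectation onto the unital subalgebra `B`. -/
def IsCondExp (B : Subalgebra ℂ M) (E : M →ₗ[ℂ] M) : Prop :=
  E 1 = 1 ∧ (∀ x, E x ∈ B) ∧ ∀ b ∈ B, ∀ b' ∈ B, ∀ x, E (b * x * b') = b * E x * b'

/-- the `L²`-distance with respect to the trace `τ`: `‖x − y‖₂`. -/
def l2Dist [StarRing M] (τ : M →ₗ[ℂ] ℂ) (x y : M) : ℝ :=
  Real.sqrt ((τ ((x - y) * star (x - y))).re)

/-- `x` belongs to `L²(S)`, the `‖·‖₂`-closure of the (star-)algebra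
generated by `S`, (intersected with `M`; conjugate variables and liberation
gradients are modelled as elements of `M` here). -/
def MemL2Closure [StarRing M] (τ : M →ₗ[ℂ] ℂ) (S : Set M) (x : M) : Prop :=
  ∀ ε : ℝ, 0 < ε → ∃ a ∈ Algebra.adjoin ℂ (S ∪ star '' S), l2Dist τ x a < ε

/-- the alternating word `c₁c̃₁ c₂c̃₂ ⋯ c_m c̃_m`. -/
def pairWord {m : ℕ} (c c' : Fin m → M) : M :=
  (List.ofFn fun r : Fin m => c r * c' r).prod

/-- the part `c₁c̃₁ ⋯ c_{r-1}c̃_{r-1}` of an alternating word before the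
(`0`-indexed) position `r`. -/
def pairWordBefore {m : ℕ} (c c' : Fin m → M) (r : Fin m) : M :=
  (((List.finRange m).filter fun s : Fin m => decide ((s : ℕ) < (r : ℕ))).map
      fun s => c s * c' s).prod

/-- the part `c_{r+1}c̃_{r+1} ⋯ c_m c̃_m` of an alternating word after the
(`0`-indexed) position `r`. -/
def pairWordAfter {m : ℕ} (c c' : Fin m → M) (r : Fin m) : M :=
  (((List.finRange m).filter fun s : Fin m => decide ((r : ℕ) < (s : ℕ))).map
      fun s => c s * c' s).prod

/-- the defining equations of the liberation gradient `j = j(A₁ : A₂)` with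
respect to the conditional expectation `E`, in their explicit form
`E(j c₁c̃₁ ⋯ c_mc̃_m) = ∑_r ( E(c₁c̃₁⋯c̃_{r-1}c_r) E(c̃_r c_{r+1}⋯c_mc̃_m)
− E(c₁c̃₁⋯c_{r-1}c̃_{r-1}) E(c_rc̃_r⋯c_mc̃_m) )`
(equivalent to `E(ja) = (E ⊗ E)(δ_{A₁:A₂} a)` for all `a ∈ A₁ ∨ A₂`). -/
def LiberationEquations {W : Type*} [Ring W] [Algebra ℂ W] (E : M →ₗ[ℂ] W)
    (S₁ S₂ : Set M) (j : M) : Prop :=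
  ∀ (m : ℕ) (c c' : Fin m → M), (∀ r, c r ∈ S₁) → (∀ r, c' r ∈ S₂) →
    E (j * pairWord c c') =
      ∑ r : Fin m,
        (E (pairWordBefore c c' r * c r) * E (c' r * pairWordAfter c c' r) -
          E (pairWordBefore c c' r) * E (c r * c' r * pairWordAfter c c' r))

/-- `j` is the liberation gradient `j_B(A₁ : A₂)` (for `E : M → B ⊆ M`), resp.
`j_ℂ(A₁ : A₂)` (for `E = τ : M → ℂ`):  it lies in `L²(A₁, A₂)` and satisfies
the defining equations `E(ja) = (E ⊗ E)(δ_{A₁:A₂} a)`. -/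
def IsLiberationGradient [StarRing M] (τ : M →ₗ[ℂ] ℂ) {W : Type*} [Ring W]
    [Algebra ℂ W] (E : M →ₗ[ℂ] W) (S₁ S₂ : Set M) (j : M) : Prop :=
  MemL2Closure τ (S₁ ∪ S₂) j ∧ LiberationEquations E S₁ S₂ j

/-- the relative commutant `B′ ∩ M`. -/
def relativeCommutant (B : Subalgebra ℂ M) : Set M :=
  {x : M | ∀ b ∈ B, b * x = x * b}

/-- the canonical evaluation map from the free algebra on (the disjoint union
of) `A₁` and `A₂` to `M`. -/
def freeWordMap (A₁ A₂ : Subalgebra ℂ M) : FreeAlgebra ℂ (↥A₁ ⊕ ↥A₂) →ₐ[ℂ] M :=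
  FreeAlgebra.lift ℂ (Sum.elim (fun a : ↥A₁ => (a : M)) (fun a : ↥A₂ => (a : M)))

/-- the defining relations of the amalgamated free product `A₁ *_B A₂`
inside the free algebra on `A₁ ⊕ A₂`. -/
def freeProductRelations (B A₁ A₂ : Subalgebra ℂ M) (h₁ : B ≤ A₁) (h₂ : B ≤ A₂) :
    Set (FreeAlgebra ℂ (↥A₁ ⊕ ↥A₂)) :=
  {x | (∃ a a' : ↥A₁, x = FreeAlgebra.ι ℂ (Sum.inl (a * a')) -
          FreeAlgebra.ι ℂ (Sum.inl a) * FreeAlgebra.ι ℂ (Sum.inl a')) ∨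
       (∃ a a' : ↥A₁, x = FreeAlgebra.ι ℂ (Sum.inl (a + a')) -
          FreeAlgebra.ι ℂ (Sum.inl a) - FreeAlgebra.ι ℂ (Sum.inl a')) ∨
       (∃ (z : ℂ) (a : ↥A₁), x = FreeAlgebra.ι ℂ (Sum.inl (z • a)) -
          z • FreeAlgebra.ι ℂ (Sum.inl a)) ∨
       (∃ a a' : ↥A₂, x = FreeAlgebra.ι ℂ (Sum.inr (a * a')) -
          FreeAlgebra.ι ℂ (Sum.inr a) * FreeAlgebra.ι ℂ (Sum.inr a')) ∨
       (∃ a a' : ↥A₂, x = FreeAlgebra.ι ℂ (Sum.inr (a + a')) -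
          FreeAlgebra.ι ℂ (Sum.inr a) - FreeAlgebra.ι ℂ (Sum.inr a')) ∨
       (∃ (z : ℂ) (a : ↥A₂), x = FreeAlgebra.ι ℂ (Sum.inr (z • a)) -
          z • FreeAlgebra.ι ℂ (Sum.inr a)) ∨
       (x = FreeAlgebra.ι ℂ (Sum.inl (1 : ↥A₁)) - 1) ∨
       (x = FreeAlgebra.ι ℂ (Sum.inr (1 : ↥A₂)) - 1) ∨
       (∃ b : ↥B, x = FreeAlgebra.ι ℂ (Sum.inl (⟨(b : M), h₁ b.2⟩ : ↥A₁)) -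
          FreeAlgebra.ι ℂ (Sum.inr (⟨(b : M), h₂ b.2⟩ : ↥A₂)))}

/-- `A₁` and `A₂` are algebraically free modulo `B`:  the canonical
homomorphism `A₁ *_B A₂ → A₁ ∨ A₂ ⊆ M` has trivial kernel, i.e. every element
of the free algebra on `A₁ ⊕ A₂` which maps to `0` in `M` already lies in the
two-sided ideal of defining relations of `A₁ *_B A₂`. -/
def AlgebraicallyFreeModulo (B A₁ A₂ : Subalgebra ℂ M) (h₁ : B ≤ A₁)
    (h₂ : B ≤ A₂) : Prop :=
  ∀ x : FreeAlgebra ℂ (↥A₁ ⊕ ↥A₂), freeWordMap A₁ A₂ x = 0 →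
    x ∈ TwoSidedIdeal.span (freeProductRelations B A₁ A₂ h₁ h₂)

/-! ### Positive functionals and orthonormal bases -/

theorem conj_apply_mul_star_of_real (Φ : M →ₗ[ℂ] ℂ) (S : Submodule ℂ M)
    (him : ∀ x ∈ S, (Φ (x * star x)).im = 0) {x y : M} (hx : x ∈ S) (hy : y ∈ S) :
    (starRingEnd ℂ) (Φ (x * star y)) = Φ (y * star x) := by
  have hxx := him x hx
  have hyy := him y hy
  have h₁ := him (x + y) (S.add_mem hx hy)
  have h₂ := him (x + Complex.I • y) (S.add_mem hx (S.smul_mem _ hy))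
  simp only [star_add, star_smul, mul_add, add_mul, map_add, smul_mul_assoc, mul_smul_comm,
    map_smul, smul_eq_mul, Complex.add_im, Complex.mul_im, Complex.mul_re, Complex.star_def,
    Complex.conj_I, Complex.neg_re, Complex.neg_im, Complex.I_re, Complex.I_im] at h₁ h₂
  apply Complex.ext
  · simp only [Complex.conj_re]; linarith
  · simp only [Complex.conj_im]; linarith

theorem exists_orthonormal_basis_of_core {V : Type*} [AddCommGroup V] [Module ℂ V]
    [FiniteDimensional ℂ V] (cd : InnerProductSpace.Core ℂ V) :
    ∃ b : Module.Basis (Fin (Module.finrank ℂ V)) ℂ V,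
      ∀ i j, cd.inner (b i) (b j) = if i = j then 1 else 0 := by
  let _ : NormedAddCommGroup V := cd.toNormedAddCommGroup
  let _ : InnerProductSpace ℂ V := InnerProductSpace.ofCore cd.toCore
  refine ⟨(stdOrthonormalBasis ℂ V).toBasis, fun i j => ?_⟩
  have h := orthonormal_iff_ite.mp (stdOrthonormalBasis ℂ V).orthonormal i j
  rw [OrthonormalBasis.coe_toBasis]
  exact h

/-- A functional which is faithful and positive on a finite-dimensional subspace admits an
orthonormal basis there; it computes expansions and traces. -/
theorem exists_orthonormal_basis_of_positive (Φ : M →ₗ[ℂ] ℂ) (S : Submodule ℂ M)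
    [FiniteDimensional ℂ S]
    (hpos : ∀ x ∈ S, 0 ≤ (Φ (x * star x)).re ∧ (Φ (x * star x)).im = 0)
    (hdef : ∀ x ∈ S, Φ (x * star x) = 0 → x = 0) :
    ∃ b : Fin (Module.finrank ℂ S) → S,
      (∀ d ∈ S, d = ∑ i, Φ (d * star (b i : M)) • (b i : M)) ∧
      ∀ f : S →ₗ[ℂ] S, LinearMap.trace ℂ S f = ∑ i, Φ ((f (b i) : M) * star (b i : M)) := by
  let cd : InnerProductSpace.Core ℂ S :=
    { inner := fun x y => Φ ((y : M) * star (x : M))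
      conj_inner_symm := fun x y =>
        conj_apply_mul_star_of_real Φ S (fun z hz => (hpos z hz).2) x.2 y.2
      re_inner_nonneg := fun x => (hpos x x.2).1
      add_left := fun x y z => by simp [mul_add]
      smul_left := fun x y r => by simp
      definite := fun x hx => Subtype.ext (hdef x x.2 hx) }
  obtain ⟨b, hb⟩ := exists_orthonormal_basis_of_core cd
  have h : ∀ i j, Φ ((b j : M) * star (b i : M)) = if i = j then 1 else 0 := hb
  have hsum : ∀ d : S, (d : M) = ∑ j, b.repr d j • (b j : M) := fun d => by
    conv_lhs => rw [← b.sum_repr d]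
    rw [S.coe_sum]
    rfl
  have hrepr : ∀ (d : S) i, b.repr d i = Φ ((d : M) * star (b i : M)) := fun d i => by
    rw [hsum d]
    simp [Finset.sum_mul, h]
  refine ⟨b, fun d hd => ?_, fun f => ?_⟩
  · simpa only [hrepr] using hsum ⟨d, hd⟩
  · rw [LinearMap.trace_eq_matrix_trace ℂ b, Matrix.trace]
    simp [LinearMap.toMatrix_apply, hrepr]

/-! ### Maps bounded in the `L²`-norm -/

/-- Boundedness of a linear map with respect to the `L²`-norm of `τ`. -/
def IsL2Bounded (τ : M →ₗ[ℂ] ℂ) (L : M →ₗ[ℂ] M) : Prop :=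
  ∃ C : ℝ, 0 ≤ C ∧ ∀ x, (τ (L x * star (L x))).re ≤ C * (τ (x * star x)).re

namespace IsFaithfulTracialState

variable {τ : M →ₗ[ℂ] ℂ}

theorem re_mul_star_nonneg (hτ : IsFaithfulTracialState τ) (x : M) :
    0 ≤ (τ (x * star x)).re := by
  rw [hτ.tracial]; exact (hτ.pos x).1

theorem im_mul_star (hτ : IsFaithfulTracialState τ) (x : M) : (τ (x * star x)).im = 0 := by
  rw [hτ.tracial]; exact (hτ.pos x).2

theorem eq_zero_of_mul_star (hτ : IsFaithfulTracialState τ) {x : M}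
    (hx : τ (x * star x) = 0) : x = 0 :=
  hτ.faithful x (by rw [hτ.tracial]; exact hx)

theorem map_star (hτ : IsFaithfulTracialState τ) (x : M) :
    τ (star x) = (starRingEnd ℂ) (τ x) := by
  have h := conj_apply_mul_star_of_real τ ⊤ (fun z _ => hτ.im_mul_star z)
    (Submodule.mem_top (x := x)) (Submodule.mem_top (x := (1 : M)))
  simpa using h.symm

theorem re_add_mul_star_le (hτ : IsFaithfulTracialState τ) (x y : M) :
    (τ ((x + y) * star (x + y))).re ≤
      2 * (τ (x * star x)).re + 2 * (τ (y * star y)).re := by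
  have h := hτ.re_mul_star_nonneg (x - y)
  simp only [star_add, star_sub, mul_add, add_mul, mul_sub, sub_mul, map_add, map_sub,
    Complex.add_re, Complex.sub_re] at h ⊢
  linarith

theorem isL2Bounded_sum (hτ : IsFaithfulTracialState τ) {ι : Type*} (s : Finset ι)
    (L : ι → M →ₗ[ℂ] M) (hL : ∀ i, IsL2Bounded τ (L i)) :
    IsL2Bounded τ (∑ i ∈ s, L i) := by
  induction s using Finset.induction_on with
  | empty => exact ⟨0, le_rfl, fun x => by simp⟩
  | insert i s hi ih =>
    obtain ⟨C, hC, h⟩ := hL i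
    obtain ⟨C', hC', h'⟩ := ih
    refine ⟨2 * C + 2 * C', by positivity, fun x => ?_⟩
    rw [Finset.sum_insert hi, LinearMap.add_apply]
    have := hτ.re_add_mul_star_le (L i x) ((∑ i ∈ s, L i) x)
    have := h x
    have := h' x
    linarith

end IsFaithfulTracialState

namespace IsL2Bounded

variable {τ : M →ₗ[ℂ] ℂ} {L L' : M →ₗ[ℂ] M}

theorem comp (h : IsL2Bounded τ L) (h' : IsL2Bounded τ L') : IsL2Bounded τ (L ∘ₗ L') := by
  obtain ⟨C, hC, h⟩ := h
  obtain ⟨C', hC', h'⟩ := h'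
  refine ⟨C * C', by positivity, fun x => (h (L' x)).trans ?_⟩
  rw [mul_assoc]
  exact mul_le_mul_of_nonneg_left (h' x) hC

theorem smul (h : IsL2Bounded τ L) (z : ℂ) : IsL2Bounded τ (z • L) := by
  obtain ⟨C, hC, h⟩ := h
  refine ⟨Complex.normSq z * C, mul_nonneg (Complex.normSq_nonneg z) hC, fun x => ?_⟩
  have hz : ((z • L) x) * star ((z • L) x) = (Complex.normSq z : ℂ) • (L x * star (L x)) := by
    rw [← Complex.mul_conj z]
    simp [smul_smul, mul_comm]
  rw [hz, map_smul, smul_eq_mul, Complex.re_ofReal_mul, mul_assoc]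
  exact mul_le_mul_of_nonneg_left (h x) (Complex.normSq_nonneg z)

/-- Left multiplication by `d` is bounded if right multiplication by `star d` is. -/
theorem mulLeft_of_mulRight_star (hτ : IsFaithfulTracialState τ) {d : M}
    (h : IsL2Bounded τ (LinearMap.mulRight ℂ (star d))) :
    IsL2Bounded τ (LinearMap.mulLeft ℂ d) := by
  obtain ⟨C, hC, h⟩ := h
  refine ⟨C, hC, fun x => ?_⟩
  have h' := h (star x)
  simp only [LinearMap.mulRight_apply, LinearMap.mulLeft_apply, star_mul, star_star] at h' ⊢
  rw [hτ.tracial x, hτ.tracial (d * x)]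
  exact h'

end IsL2Bounded

/-! ### Orthonormal bases for the trace of the regular representation -/

/-- `e` is a basis of `D` which is orthonormal for a functional `T` on `M` whose restriction to `D`
is a trace, in the sense that `D` is expanded in `e` with the coefficients given by `T`, and which
is normalized by `∑ e_i e_i^* = 1`. -/
structure IsCasimirFamily {n : ℕ} (D : Subalgebra ℂ M) (T : M →ₗ[ℂ] ℂ) (e : Fin n → M) :
    Prop where
  star_mem : ∀ d ∈ D, star d ∈ D
  tracial : ∀ d ∈ D, ∀ d' ∈ D, T (d * d') = T (d' * d)
  map_star : ∀ d ∈ D, T (star d) = (starRingEnd ℂ) (T d)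
  mem : ∀ i, e i ∈ D
  expand : ∀ d ∈ D, d = ∑ i, T (d * star (e i)) • e i
  sum_mul_star : ∑ i, e i * star (e i) = 1

namespace IsCasimirFamily

variable {n : ℕ} {D : Subalgebra ℂ M} {T : M →ₗ[ℂ] ℂ} {e : Fin n → M}

theorem expand_star (he : IsCasimirFamily D T e) {d : M} (hd : d ∈ D) :
    d = ∑ i, T (e i * d) • star (e i) := by
  have h := congrArg star (he.expand (star d) (he.star_mem d hd))
  rw [star_star, star_sum] at h
  refine h.trans (Finset.sum_congr rfl fun i _ => ?_)
  rw [star_smul, ← star_mul, he.map_star _ (D.mul_mem (he.mem i) hd), Complex.star_def,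
    Complex.conj_conj]

theorem sum_star_mul (he : IsCasimirFamily D T e) : ∑ i, star (e i) * e i = 1 := by
  rw [← he.sum_mul_star]
  have h₁ : ∀ i, star (e i) * e i =
      ∑ j, T (star (e i) * star (e j)) • (e j * e i) := fun i => by
    conv_lhs => rw [he.expand _ (he.star_mem _ (he.mem i))]
    simp [Finset.sum_mul]
  have h₂ : ∀ j, e j * star (e j) =
      ∑ i, T (star (e j) * star (e i)) • (e j * e i) := fun j => by
    conv_lhs => rw [he.expand _ (he.star_mem _ (he.mem j))]
    simp [Finset.mul_sum]
  simp_rw [h₁, h₂]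
  rw [Finset.sum_comm]
  refine Finset.sum_congr rfl fun j _ => Finset.sum_congr rfl fun i _ => ?_
  rw [he.tracial _ (he.star_mem _ (he.mem i)) _ (he.star_mem _ (he.mem j))]

theorem casimir_comm (he : IsCasimirFamily D T e) {d : M} (hd : d ∈ D) (x : M) :
    d * ∑ i, e i * x * star (e i) = (∑ i, e i * x * star (e i)) * d := by
  have h₁ : ∀ i, d * (e i * x * star (e i)) =
      ∑ j, T (d * e i * star (e j)) • (e j * x * star (e i)) := fun i => by
    rw [mul_assoc (e i), ← mul_assoc d]
    conv_lhs => rw [he.expand _ (D.mul_mem hd (he.mem i))]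
    simp [Finset.sum_mul, mul_assoc]
  have h₂ : ∀ j, e j * x * star (e j) * d =
      ∑ i, T (e i * (star (e j) * d)) • (e j * x * star (e i)) := fun j => by
    rw [mul_assoc _ _ d]
    conv_lhs => rw [he.expand_star (D.mul_mem (he.star_mem _ (he.mem j)) hd)]
    simp [Finset.mul_sum]
  simp_rw [Finset.mul_sum, Finset.sum_mul, h₁, h₂]
  rw [Finset.sum_comm]
  refine Finset.sum_congr rfl fun j _ => Finset.sum_congr rfl fun i _ => ?_
  rw [mul_assoc, he.tracial d hd _ (D.mul_mem (he.mem i) (he.star_mem _ (he.mem j))), mul_assoc]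

/-- The averaging map `x ↦ ∑ e_i x e_i^*` is the trace-preserving conditional expectation onto the
relative commutant. -/
theorem condExp_commutant_eq (he : IsCasimirFamily D T e) {τ : M →ₗ[ℂ] ℂ}
    (hτ : IsFaithfulTracialState τ) (E' : M →ₗ[ℂ] M)
    (hE'mem : ∀ x, E' x ∈ relativeCommutant D)
    (hE'τ : ∀ x, τ (E' x) = τ x)
    (hE'bimod : ∀ a ∈ relativeCommutant D, ∀ b ∈ relativeCommutant D, ∀ x,
      E' (a * x * b) = a * E' x * b) (x : M) :
    E' x = ∑ i, e i * x * star (e i) := by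
  set P : M := ∑ i, e i * x * star (e i) with hP
  have hPτ : ∀ y ∈ relativeCommutant D, τ (P * y) = τ (x * y) := fun y hy => by
    have h : ∀ i, τ (e i * x * star (e i) * y) = τ (x * y * (star (e i) * e i)) := fun i => by
      rw [mul_assoc, hy _ (he.star_mem _ (he.mem i)), mul_assoc, hτ.tracial]
      simp only [mul_assoc]
    rw [hP, Finset.sum_mul, map_sum, Finset.sum_congr rfl fun i _ => h i, ← map_sum,
      ← Finset.mul_sum, he.sum_star_mul, mul_one]
  have hEτ : ∀ y ∈ relativeCommutant D, τ (E' x * y) = τ (x * y) := fun y hy => by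
    have h := hE'bimod 1 (fun b _ => by simp) y hy x
    rw [one_mul, one_mul] at h
    rw [← h, hE'τ]
  have hcomm : E' x - P ∈ relativeCommutant D := fun b hb => by
    rw [mul_sub, sub_mul, hE'mem x b hb, hP, he.casimir_comm hb]
  have hstar : star (E' x - P) ∈ relativeCommutant D := fun b hb => by
    have h := congrArg star (hcomm (star b) (he.star_mem b hb))
    simpa only [star_mul, star_star] using h.symm
  refine sub_eq_zero.mp (hτ.eq_zero_of_mul_star ?_)
  rw [sub_mul, map_sub, hPτ _ hstar, hEτ _ hstar, sub_self]

theorem isL2Bounded_mulRight (he : IsCasimirFamily D T e) {τ : M →ₗ[ℂ] ℂ}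
    (hτ : IsFaithfulTracialState τ) {d : M} (hd : d ∈ D) :
    IsL2Bounded τ (LinearMap.mulRight ℂ d) := by
  have hi : ∀ i, IsL2Bounded τ (LinearMap.mulRight ℂ (e i)) := fun i => by
    refine ⟨1, zero_le_one, fun x => ?_⟩
    have h : ∑ j, (τ (x * e j * star (x * e j))).re = (τ (x * star x)).re := by
      rw [← Complex.re_sum, ← map_sum]
      have hj : ∀ j, x * e j * star (x * e j) = x * (e j * star (e j)) * star x := fun j => by
        simp only [star_mul, mul_assoc]
      rw [Finset.sum_congr rfl fun j _ => hj j, ← Finset.sum_mul, ← Finset.mul_sum,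
        he.sum_mul_star, mul_one]
    rw [one_mul, ← h]
    exact Finset.single_le_sum (f := fun j => (τ (x * e j * star (x * e j))).re)
      (fun j _ => hτ.re_mul_star_nonneg _) (Finset.mem_univ i)
  have hsum : LinearMap.mulRight ℂ d =
      ∑ i, T (d * star (e i)) • LinearMap.mulRight ℂ (e i) := by
    ext x
    conv_lhs => rw [LinearMap.mulRight_apply, he.expand d hd]
    simp [Finset.mul_sum]
  rw [hsum]
  exact hτ.isL2Bounded_sum _ _ fun i => (hi i).smul _

theorem isL2Bounded_mulLeft (he : IsCasimirFamily D T e) {τ : M →ₗ[ℂ] ℂ}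
    (hτ : IsFaithfulTracialState τ) {d : M} (hd : d ∈ D) :
    IsL2Bounded τ (LinearMap.mulLeft ℂ d) :=
  .mulLeft_of_mulRight_star hτ (he.isL2Bounded_mulRight hτ (he.star_mem d hd))

end IsCasimirFamily

/-- If a scalar multiple of `τ (b ·)`, with `b` self-adjoint and central in `D`, is the trace of the
regular representation of `D`, then it has a Casimir family. -/
theorem exists_isCasimirFamily {τ : M →ₗ[ℂ] ℂ} (hτ : IsFaithfulTracialState τ)
    (D : Subalgebra ℂ M) [FiniteDimensional ℂ D] (hDstar : ∀ d ∈ D, star d ∈ D)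
    {b : M} (hbstar : star b = b) (hbcentral : ∀ d ∈ D, b * d = d * b) (s : ℕ)
    (htrace : ∀ d : D, (s : ℂ) * τ (b * (d : M)) =
      LinearMap.trace ℂ D (LinearMap.mulLeft ℂ d)) :
    ∃ e : Fin (Module.finrank ℂ D) → M,
      IsCasimirFamily D ((s : ℂ) • (τ ∘ₗ LinearMap.mulLeft ℂ b)) e := by
  set T : M →ₗ[ℂ] ℂ := (s : ℂ) • (τ ∘ₗ LinearMap.mulLeft ℂ b) with hT
  have hTtr : ∀ d : D, T (d : M) = LinearMap.trace ℂ D (LinearMap.mulLeft ℂ d) := fun d => by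
    simp [hT, ← htrace]
  have htracial : ∀ d ∈ D, ∀ d' ∈ D, T (d * d') = T (d' * d) := fun d hd d' hd' => by
    simp only [hT, LinearMap.smul_apply, LinearMap.comp_apply, LinearMap.mulLeft_apply]
    rw [← mul_assoc, hbcentral d hd, mul_assoc, hτ.tracial, mul_assoc]
  have hmapstar : ∀ d ∈ D, T (star d) = (starRingEnd ℂ) (T d) := fun d hd => by
    simp only [hT, LinearMap.smul_apply, LinearMap.comp_apply, LinearMap.mulLeft_apply,
      smul_eq_mul, map_mul, map_natCast, ← hτ.map_star, star_mul, hbstar,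
      hbcentral _ (hDstar d hd)]
  obtain ⟨g, hgexp, hgtr⟩ := exists_orthonormal_basis_of_positive τ (Subalgebra.toSubmodule D)
    (fun x _ => ⟨hτ.re_mul_star_nonneg x, hτ.im_mul_star x⟩)
    (fun x _ hx => hτ.eq_zero_of_mul_star hx)
  have hTg : ∀ d (hd : d ∈ D), T (d * star d) =
      ∑ i, τ (star d * (g i : M) * star (star d * (g i : M))) := fun d hd => by
    refine (hTtr (⟨d, hd⟩ * ⟨star d, hDstar d hd⟩)).trans
      ((hgtr _).trans (Finset.sum_congr rfl fun i _ => ?_))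
    change τ (d * star d * (g i : M) * star (g i : M)) = _
    rw [mul_assoc, mul_assoc, hτ.tracial]
    simp only [star_mul, star_star, mul_assoc]
  have hpos : ∀ x ∈ D, 0 ≤ (T (x * star x)).re ∧ (T (x * star x)).im = 0 := fun x hx => by
    rw [hTg x hx, Complex.re_sum, Complex.im_sum]
    exact ⟨Finset.sum_nonneg fun i _ => hτ.re_mul_star_nonneg _,
      Finset.sum_eq_zero fun i _ => hτ.im_mul_star _⟩
  have hdef : ∀ x ∈ D, T (x * star x) = 0 → x = 0 := fun x hx h0 => by
    have h := congrArg Complex.re (hTg x hx)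
    rw [h0, Complex.re_sum, Complex.zero_re, eq_comm,
      Finset.sum_eq_zero_iff_of_nonneg fun i _ => hτ.re_mul_star_nonneg _] at h
    have hgi : ∀ i, star x * (g i : M) = 0 := fun i =>
      hτ.eq_zero_of_mul_star (Complex.ext (h i (Finset.mem_univ i)) (hτ.im_mul_star _))
    have hx0 : star x * 1 = 0 := by
      rw [hgexp 1 D.one_mem]; simp [Finset.mul_sum, hgi]
    simpa using hx0
  obtain ⟨f, hfexp, hftr⟩ := exists_orthonormal_basis_of_positive T (Subalgebra.toSubmodule D) hpos hdef
  have hfmem : ∀ i, (f i : M) ∈ D := fun i => (f i).2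
  refine ⟨fun i => (f i : M), hDstar, htracial, hmapstar, hfmem, hfexp, ?_⟩
  set z : M := ∑ i, (f i : M) * star (f i : M) with hz
  have hzD : z ∈ D := D.sum_mem fun i _ => D.mul_mem (hfmem i) (hDstar _ (hfmem i))
  have hTz : ∀ d ∈ D, T d = T (d * z) := fun d hd => by
    refine (hTtr ⟨d, hd⟩).trans ((hftr _).trans ?_)
    rw [hz, Finset.mul_sum, map_sum]
    refine Finset.sum_congr rfl fun i _ => ?_
    exact congrArg T (mul_assoc d _ _)
  have hmem : 1 - z ∈ D := D.sub_mem D.one_mem hzD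
  refine (sub_eq_zero.mp (hdef _ hmem ?_)).symm
  rw [htracial _ hmem _ (hDstar _ hmem), mul_sub, mul_one, map_sub,
    ← hTz _ (hDstar _ hmem), sub_self]

/-! ### Alternating words as lists -/

/-- The alternating word `a₁b₁a₂b₂⋯` of a list of pairs `(a₁, b₁), (a₂, b₂), …`. -/
def listWord (l : List (M × M)) : M := (l.map fun p => p.1 * p.2).prod

@[simp]
theorem listWord_nil : listWord ([] : List (M × M)) = 1 := rfl

@[simp]
theorem listWord_cons (p : M × M) (l : List (M × M)) :
    listWord (p :: l) = p.1 * p.2 * listWord l := by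
  simp [listWord]

@[simp]
theorem listWord_append (l l' : List (M × M)) :
    listWord (l ++ l') = listWord l * listWord l' := by
  simp [listWord]

/-- The right-hand side of the liberation equations, for the word `x · listWord l · y` in which only
the letters of `l` are differentiated and with `B` in place of the product of two expectations. -/
def liberationSum {W : Type*} [AddCommGroup W] (B : M → M → W) : List (M × M) → M → M → W
  | [], _, _ => 0
  | p :: l, x, y =>
    B (x * p.1) (p.2 * listWord l * y) - B x (p.1 * p.2 * listWord l * y) +
      liberationSum B l (x * p.1 * p.2) y

theorem liberationSum_append {W : Type*} [AddCommGroup W] (B : M → M → W) (l l' : List (M × M))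
    (x y : M) :
    liberationSum B (l ++ l') x y =
      liberationSum B l x (listWord l' * y) + liberationSum B l' (x * listWord l) y := by
  induction l generalizing x with
  | nil => simp [liberationSum]
  | cons p l ih =>
    simp only [List.cons_append, liberationSum, ih, listWord_append, listWord_cons, mul_assoc]
    abel

theorem pairWordBefore_zero {m : ℕ} (c c' : Fin (m + 1) → M) : pairWordBefore c c' 0 = 1 := by
  simp [pairWordBefore]

theorem pairWordBefore_succ {m : ℕ} (c c' : Fin (m + 1) → M) (r : Fin m) :
    pairWordBefore c c' r.succ =
      c 0 * c' 0 * pairWordBefore (fun i => c i.succ) (fun i => c' i.succ) r := by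
  simp [pairWordBefore, List.finRange_succ, List.filter_map, Function.comp_def]

theorem pairWordAfter_zero {m : ℕ} (c c' : Fin (m + 1) → M) :
    pairWordAfter c c' 0 = pairWord (fun i => c i.succ) (fun i => c' i.succ) := by
  simp [pairWordAfter, pairWord, List.finRange_succ, List.filter_map, Function.comp_def,
    List.ofFn_eq_map]

theorem pairWordAfter_succ {m : ℕ} (c c' : Fin (m + 1) → M) (r : Fin m) :
    pairWordAfter c c' r.succ =
      pairWordAfter (fun i => c i.succ) (fun i => c' i.succ) r := by
  simp [pairWordAfter, List.finRange_succ, List.filter_map, Function.comp_def]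

theorem pairWord_eq_listWord {m : ℕ} (c c' : Fin m → M) :
    pairWord c c' = listWord (List.ofFn fun r => (c r, c' r)) := by
  simp [pairWord, listWord, List.map_ofFn, Function.comp_def]

theorem sum_eq_liberationSum {W : Type*} [AddCommGroup W] (B : M → M → W) {m : ℕ}
    (c c' : Fin m → M) (x : M) :
    ∑ r, (B (x * (pairWordBefore c c' r * c r)) (c' r * pairWordAfter c c' r) -
        B (x * pairWordBefore c c' r) (c r * c' r * pairWordAfter c c' r)) =
      liberationSum B (List.ofFn fun r => (c r, c' r)) x 1 := by
  induction m generalizing x with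
  | zero => simp [liberationSum]
  | succ m ih =>
    rw [Fin.sum_univ_succ, List.ofFn_succ, liberationSum, ← pairWord_eq_listWord, ← ih]
    simp only [pairWordBefore_zero, pairWordAfter_zero, pairWordBefore_succ, pairWordAfter_succ,
      mul_one, one_mul, mul_assoc]

theorem liberationEquations_iff {W : Type*} [Ring W] [Algebra ℂ W] (E : M →ₗ[ℂ] W)
    (S₁ S₂ : Set M) (j : M) :
    LiberationEquations E S₁ S₂ j ↔
      ∀ l : List (M × M), (∀ p ∈ l, p.1 ∈ S₁ ∧ p.2 ∈ S₂) →
        E (j * listWord l) = liberationSum (fun x y => E x * E y) l 1 1 := by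
  constructor
  · intro h l hl
    have h' := h l.length (fun r => (l.get r).1) (fun r => (l.get r).2)
      (fun r => (hl _ (l.get_mem r)).1) (fun r => (hl _ (l.get_mem r)).2)
    have hs := sum_eq_liberationSum (fun x y => E x * E y) (fun r => (l.get r).1)
      (fun r => (l.get r).2) 1
    simp only [one_mul] at hs
    rw [hs, pairWord_eq_listWord] at h'
    simpa using h'
  · intro h m c c' hc hc'
    have hs := sum_eq_liberationSum (fun x y => E x * E y) c c' 1
    simp only [one_mul] at hs
    rw [hs, pairWord_eq_listWord]
    refine h _ fun p hp => ?_
    obtain ⟨r, rfl⟩ := List.mem_ofFn.mp hp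
    exact ⟨hc r, hc' r⟩

/-! ### Extending the scalar liberation equations to the generated algebra -/

/-- The Leibniz rule on pairs `(w, F)`, where the bilinear form `F` stands for
`(x, y) ↦ (τ ⊗ τ)(x · δ(w) · y)`. -/
def leibniz (w : M) (F : M →ₗ[ℂ] M →ₗ[ℂ] ℂ) (v : M) (H : M →ₗ[ℂ] M →ₗ[ℂ] ℂ) :
    M →ₗ[ℂ] M →ₗ[ℂ] ℂ :=
  H.compl₁₂ (LinearMap.mulRight ℂ w) LinearMap.id + F.compl₁₂ LinearMap.id (LinearMap.mulLeft ℂ v)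

@[simp]
theorem leibniz_apply (w : M) (F : M →ₗ[ℂ] M →ₗ[ℂ] ℂ) (v : M) (H : M →ₗ[ℂ] M →ₗ[ℂ] ℂ) (x y : M) :
    leibniz w F v H x y = H (x * w) y + F x (v * y) := rfl

/-- The form `(x, y) ↦ (τ ⊗ τ)(x · (a ⊗ 1 - 1 ⊗ a) · y)`. -/
def commutatorForm (τ : M →ₗ[ℂ] ℂ) (a : M) : M →ₗ[ℂ] M →ₗ[ℂ] ℂ :=
  (LinearMap.mul ℂ ℂ).compl₁₂ (τ ∘ₗ LinearMap.mulRight ℂ a) τ -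
    (LinearMap.mul ℂ ℂ).compl₁₂ τ (τ ∘ₗ LinearMap.mulLeft ℂ a)

@[simp]
theorem commutatorForm_apply (τ : M →ₗ[ℂ] ℂ) (a x y : M) :
    commutatorForm τ a x y = τ (x * a) * τ y - τ x * τ (a * y) := rfl

/-- The scalar liberation equations for the words in `A₁` and `A₂` followed by `v`, when `H`
represents the derivative of `v`. -/
def IsLiberationSuffix (τ : M →ₗ[ℂ] ℂ) (S₁ S₂ : Set M) (j v : M) (H : M →ₗ[ℂ] M →ₗ[ℂ] ℂ) : Prop :=
  ∀ l : List (M × M), (∀ p ∈ l, p.1 ∈ S₁ ∧ p.2 ∈ S₂) →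
    τ (j * (listWord l * v)) =
      H (listWord l) 1 + liberationSum (fun x y => τ x * τ y) l 1 v

/-- `F` represents the derivative of `w`, as far as the scalar liberation equations for `j` can
tell. -/
def IsLiberationDeriv (τ : M →ₗ[ℂ] ℂ) (S₁ S₂ : Set M) (j w : M) (F : M →ₗ[ℂ] M →ₗ[ℂ] ℂ) : Prop :=
  ∀ v H, IsLiberationSuffix τ S₁ S₂ j v H →
    IsLiberationSuffix τ S₁ S₂ j (w * v) (leibniz w F v H)

theorem liberationSum_add_right (τ : M →ₗ[ℂ] ℂ) (l : List (M × M)) (x y y' : M) :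
    liberationSum (fun x y => τ x * τ y) l x (y + y') =
      liberationSum (fun x y => τ x * τ y) l x y +
        liberationSum (fun x y => τ x * τ y) l x y' := by
  induction l generalizing x with
  | nil => simp [liberationSum]
  | cons p l ih => simp only [liberationSum, ih, mul_add, map_add]; ring

namespace IsLiberationDeriv

variable {τ : M →ₗ[ℂ] ℂ} {S₁ S₂ : Set M} {j w w' : M} {F F' : M →ₗ[ℂ] M →ₗ[ℂ] ℂ}

theorem add (h : IsLiberationDeriv τ S₁ S₂ j w F) (h' : IsLiberationDeriv τ S₁ S₂ j w' F') :
    IsLiberationDeriv τ S₁ S₂ j (w + w') (F + F') := fun v H hv l hl => by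
  have e := h v H hv l hl
  have e' := h' v H hv l hl
  simp only [leibniz_apply, add_mul, mul_add, map_add, LinearMap.add_apply,
    liberationSum_add_right] at e e' ⊢
  rw [e, e']
  ring

theorem mul (h : IsLiberationDeriv τ S₁ S₂ j w F) (h' : IsLiberationDeriv τ S₁ S₂ j w' F') :
    IsLiberationDeriv τ S₁ S₂ j (w * w') (leibniz w F w' F') := fun v H hv l hl => by
  have e := h _ _ (h' v H hv) l hl
  simp only [leibniz_apply, mul_assoc] at e ⊢
  rw [e]
  ring

theorem of_mem_left (hone : (1 : M) ∈ S₂) {a : M} (ha : a ∈ S₁) :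
    IsLiberationDeriv τ S₁ S₂ j a (commutatorForm τ a) := fun v H hv l hl => by
  have e := hv (l ++ [(a, 1)]) (by
    intro p hp
    rcases List.mem_append.mp hp with hp | hp
    · exact hl p hp
    · rw [List.mem_singleton.mp hp]; exact ⟨ha, hone⟩)
  simp only [listWord_append, listWord_cons, listWord_nil, liberationSum_append, liberationSum,
    leibniz_apply, commutatorForm_apply, mul_one, one_mul, mul_assoc, add_zero] at e ⊢
  rw [e]
  ring

theorem of_mem_right (hone : (1 : M) ∈ S₁) {b : M} (hb : b ∈ S₂) :
    IsLiberationDeriv τ S₁ S₂ j b 0 := fun v H hv l hl => by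
  have e := hv (l ++ [(1, b)]) (by
    intro p hp
    rcases List.mem_append.mp hp with hp | hp
    · exact hl p hp
    · rw [List.mem_singleton.mp hp]; exact ⟨hone, hb⟩)
  simp only [listWord_append, listWord_cons, listWord_nil, liberationSum_append, liberationSum,
    leibniz_apply, LinearMap.zero_apply, mul_one, one_mul, mul_assoc, add_zero, sub_self] at e ⊢
  exact e

theorem apply_eq (hj : LiberationEquations τ S₁ S₂ j) (h : IsLiberationDeriv τ S₁ S₂ j w F) :
    τ (j * w) = F 1 1 := by
  have h1 : IsLiberationSuffix τ S₁ S₂ j 1 0 := fun l hl => by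
    simpa using (liberationEquations_iff τ S₁ S₂ j).mp hj l hl
  simpa [liberationSum] using h 1 0 h1 [] (by simp)

end IsLiberationDeriv

/-! ### Passing to the `D`-valued liberation equations -/

theorem IsCondExp.apply_mul {τ : M →ₗ[ℂ] ℂ} {D : Subalgebra ℂ M} {ED : M →ₗ[ℂ] M}
    (hED : IsCondExp D ED) (hEDτ : ∀ x, τ (ED x) = τ x) {d : M} (hd : d ∈ D) (x : M) :
    τ (ED x * d) = τ (x * d) := by
  have h := hED.2.2 1 D.one_mem d hd x
  rw [one_mul, one_mul] at h
  rw [← h, hEDτ]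

/-- The contraction `(x, y) ↦ s · ∑ F (e_i^* b x, y e_i)` of a bilinear form. -/
def averageForm {n : ℕ} (s : ℕ) (b : M) (e : Fin n → M) (F : M →ₗ[ℂ] M →ₗ[ℂ] ℂ) (x y : M) : ℂ :=
  (s : ℂ) * ∑ i, F (star (e i) * b * x) (y * e i)

theorem averageForm_add {n : ℕ} (s : ℕ) (b : M) (e : Fin n → M) (F F' : M →ₗ[ℂ] M →ₗ[ℂ] ℂ)
    (x y : M) :
    averageForm s b e (F + F') x y = averageForm s b e F x y + averageForm s b e F' x y := by
  simp [averageForm, Finset.sum_add_distrib, mul_add]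

theorem averageForm_leibniz {n : ℕ} (s : ℕ) (b : M) (e : Fin n → M) (w v : M)
    (F H : M →ₗ[ℂ] M →ₗ[ℂ] ℂ) (x y : M) :
    averageForm s b e (leibniz w F v H) x y =
      averageForm s b e H (x * w) y + averageForm s b e F x (v * y) := by
  simp [averageForm, Finset.sum_add_distrib, mul_add, mul_assoc]

namespace IsCasimirFamily

variable {n : ℕ} {D : Subalgebra ℂ M} {τ : M →ₗ[ℂ] ℂ} {s : ℕ} {b : M} {e : Fin n → M}

theorem sum_eq_condExp (he : IsCasimirFamily D ((s : ℂ) • (τ ∘ₗ LinearMap.mulLeft ℂ b)) e)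
    (hτ : IsFaithfulTracialState τ) (hb : b ∈ D) {ED : M →ₗ[ℂ] M}
    (hED : IsCondExp D ED) (hEDτ : ∀ x, τ (ED x) = τ x) (x y : M) :
    (s : ℂ) * ∑ i, τ (star (e i) * b * x) * τ (y * e i) = τ (ED x * y) := by
  have h : ∀ i, τ (b * (ED x * star (e i))) = τ (star (e i) * b * x) := fun i => by
    have hsb : star (e i) * b ∈ D := D.mul_mem (he.star_mem _ (he.mem i)) hb
    rw [hτ.tracial, mul_assoc, hED.apply_mul hEDτ hsb, hτ.tracial]
  conv_rhs => rw [he.expand _ (hED.2.1 x)]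
  simp only [LinearMap.smul_apply, LinearMap.comp_apply, LinearMap.mulLeft_apply, smul_eq_mul, h,
    Finset.sum_mul, Finset.mul_sum, map_sum, smul_mul_assoc, map_smul]
  refine Finset.sum_congr rfl fun i _ => ?_
  rw [hτ.tracial y]
  ring

theorem averageForm_commutatorForm
    (he : IsCasimirFamily D ((s : ℂ) • (τ ∘ₗ LinearMap.mulLeft ℂ b)) e)
    (hτ : IsFaithfulTracialState τ) (hb : b ∈ D) {ED : M →ₗ[ℂ] M}
    (hED : IsCondExp D ED) (hEDτ : ∀ x, τ (ED x) = τ x) (a x y : M) :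
    averageForm s b e (commutatorForm τ a) x y = τ (ED (x * a) * y) - τ (ED x * (a * y)) := by
  rw [← he.sum_eq_condExp hτ hb hED hEDτ, ← he.sum_eq_condExp hτ hb hED hEDτ, ← mul_sub,
    ← Finset.sum_sub_distrib]
  simp only [averageForm, commutatorForm_apply, mul_assoc]

theorem exists_isLiberationDeriv
    (he : IsCasimirFamily D ((s : ℂ) • (τ ∘ₗ LinearMap.mulLeft ℂ b)) e)
    (hτ : IsFaithfulTracialState τ) (hb : b ∈ D) {ED : M →ₗ[ℂ] M}
    (hED : IsCondExp D ED) (hEDτ : ∀ x, τ (ED x) = τ x)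
    {A₁ A₂ : Subalgebra ℂ M} (hDA₂ : D ≤ A₂) (j : M) {a : M} (ha : a ∈ A₁ ⊔ D) :
    ∃ F, IsLiberationDeriv τ (A₁ : Set M) (A₂ : Set M) j a F ∧
      ∀ x y, averageForm s b e F x y = τ (ED (x * a) * y) - τ (ED x * (a * y)) := by
  rw [Algebra.sup_def] at ha
  have hleft : ∀ a ∈ A₁, ∃ F, IsLiberationDeriv τ (A₁ : Set M) (A₂ : Set M) j a F ∧
      ∀ x y, averageForm s b e F x y = τ (ED (x * a) * y) - τ (ED x * (a * y)) := fun a ha =>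
    ⟨commutatorForm τ a, .of_mem_left A₂.one_mem ha,
      he.averageForm_commutatorForm hτ hb hED hEDτ a⟩
  induction ha using Algebra.adjoin_induction with
  | mem a ha =>
    rcases ha with ha | ha
    · exact hleft a ha
    · refine ⟨0, .of_mem_right A₁.one_mem (hDA₂ ha), fun x y => ?_⟩
      have h := hED.2.2 1 D.one_mem a ha x
      rw [one_mul, one_mul] at h
      rw [h, mul_assoc, sub_self]
      simp [averageForm]
  | algebraMap r => exact hleft _ (A₁.algebraMap_mem r)
  | add a a' _ _ h h' =>
    obtain ⟨F, hF, hav⟩ := h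
    obtain ⟨F', hF', hav'⟩ := h'
    refine ⟨F + F', hF.add hF', fun x y => ?_⟩
    rw [averageForm_add, hav, hav']
    simp only [mul_add, add_mul, map_add]
    ring
  | mul a a' _ _ h h' =>
    obtain ⟨F, hF, hav⟩ := h
    obtain ⟨F', hF', hav'⟩ := h'
    refine ⟨leibniz a F a' F', hF.mul hF', fun x y => ?_⟩
    rw [averageForm_leibniz, hav, hav']
    simp only [mul_assoc]
    ring

theorem exists_isLiberationDeriv_listWord
    (he : IsCasimirFamily D ((s : ℂ) • (τ ∘ₗ LinearMap.mulLeft ℂ b)) e)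
    (hτ : IsFaithfulTracialState τ) (hb : b ∈ D) {ED : M →ₗ[ℂ] M}
    (hED : IsCondExp D ED) (hEDτ : ∀ x, τ (ED x) = τ x)
    {A₁ A₂ : Subalgebra ℂ M} (hDA₂ : D ≤ A₂) (j : M) (l : List (M × M))
    (hl : ∀ p ∈ l, p.1 ∈ A₁ ⊔ D ∧ p.2 ∈ A₂) :
    ∃ F, IsLiberationDeriv τ (A₁ : Set M) (A₂ : Set M) j (listWord l) F ∧
      ∀ x y, averageForm s b e F x y = liberationSum (fun u v => τ (ED u * v)) l x y := by
  induction l with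
  | nil =>
    exact ⟨0, .of_mem_right A₁.one_mem A₂.one_mem, fun x y => by
      simp [averageForm, liberationSum]⟩
  | cons p l ih =>
    obtain ⟨hp₁, hp₂⟩ := hl p List.mem_cons_self
    obtain ⟨F, hF, hav⟩ := ih fun q hq => hl q (List.mem_cons_of_mem p hq)
    obtain ⟨G, hG, hav'⟩ := he.exists_isLiberationDeriv hτ hb hED hEDτ hDA₂ j hp₁
    have h0 : IsLiberationDeriv τ (A₁ : Set M) (A₂ : Set M) j p.2 0 :=
      .of_mem_right A₁.one_mem hp₂
    rw [listWord_cons]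
    refine ⟨_, (hG.mul h0).mul hF, fun x y => ?_⟩
    rw [averageForm_leibniz, averageForm_leibniz, hav, hav', liberationSum]
    simp only [averageForm, LinearMap.zero_apply, Finset.sum_const_zero, mul_zero, mul_assoc]
    ring

end IsCasimirFamily

theorem IsCondExp.apply_liberationSum_mul {τ : M →ₗ[ℂ] ℂ} {D : Subalgebra ℂ M} {ED : M →ₗ[ℂ] M}
    (hτ : IsFaithfulTracialState τ) (hED : IsCondExp D ED) (hEDτ : ∀ x, τ (ED x) = τ x)
    {d : M} (hd : d ∈ D) (l : List (M × M)) (x y : M) :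
    τ (liberationSum (fun u v => ED u * ED v) l x y * d) =
      liberationSum (fun u v => τ (ED u * v)) l x (y * d) := by
  have h : ∀ u v, τ (ED u * (ED v * d)) = τ (ED u * (v * d)) := fun u v => by
    rw [← mul_assoc, hτ.tracial, ← mul_assoc, hτ.tracial,
      hED.apply_mul hEDτ (D.mul_mem hd (hED.2.1 u)), hτ.tracial, mul_assoc, hτ.tracial]
    simp only [mul_assoc]
  induction l generalizing x with
  | nil => simp [liberationSum]
  | cons p l ih =>
    simp only [liberationSum, add_mul, sub_mul, map_add, map_sub, h, ih, mul_assoc]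

theorem IsCondExp.liberationSum_mem {D : Subalgebra ℂ M} {ED : M →ₗ[ℂ] M} (hED : IsCondExp D ED)
    (l : List (M × M)) (x y : M) : liberationSum (fun u v => ED u * ED v) l x y ∈ D := by
  induction l generalizing x with
  | nil => exact D.zero_mem
  | cons p l ih =>
    exact D.add_mem (D.sub_mem (D.mul_mem (hED.2.1 _) (hED.2.1 _))
      (D.mul_mem (hED.2.1 _) (hED.2.1 _))) (ih _)

/-- The `L²`-closure of a set is mapped into the `L²`-closure of another one by a bounded linear map
which maps the algebras accordingly. -/
theorem MemL2Closure.map {τ : M →ₗ[ℂ] ℂ} {S S' : Set M} {x : M} {L : M →ₗ[ℂ] M}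
    (hx : MemL2Closure τ S x) (hL : IsL2Bounded τ L)
    (hmaps : ∀ a ∈ Algebra.adjoin ℂ (S ∪ star '' S), L a ∈ Algebra.adjoin ℂ (S' ∪ star '' S')) :
    MemL2Closure τ S' (L x) := by
  obtain ⟨C, hC, hbd⟩ := hL
  intro ε hε
  obtain ⟨a, ha, hax⟩ := hx (ε / (Real.sqrt C + 1)) (by positivity)
  refine ⟨L a, hmaps a ha, ?_⟩
  have h : l2Dist τ (L x) (L a) ≤ Real.sqrt C * l2Dist τ x a := by
    rw [l2Dist, l2Dist, ← Real.sqrt_mul hC, ← map_sub]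
    exact Real.sqrt_le_sqrt (hbd _)
  have h0 : 0 ≤ l2Dist τ x a := Real.sqrt_nonneg _
  rw [lt_div_iff₀ (by positivity)] at hax
  nlinarith

theorem liberation_gradient_relative_to_finite_dimensional_D
    (τ : M →ₗ[ℂ] ℂ) (hτ : IsFaithfulTracialState τ)
    (D : Subalgebra ℂ M) [FiniteDimensional ℂ ↥D] (hDstar : ∀ d ∈ D, star d ∈ D)
    (ED : M →ₗ[ℂ] M) (hED : IsCondExp D ED) (hEDτ : ∀ x, τ (ED x) = τ x)
    -- `E'` is the trace-preserving conditional expectation `E_{D'}` onto the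
    -- relative commutant `D′ ∩ M` (given by `E_{D'}(x) = ∫_U u x u* du`)
    (E' : M →ₗ[ℂ] M)
    (hE'mem : ∀ x, E' x ∈ relativeCommutant D)
    (hE'id : ∀ x ∈ relativeCommutant D, E' x = x)
    (hE'τ : ∀ x, τ (E' x) = τ x)
    (hE'bimod : ∀ a ∈ relativeCommutant D, ∀ b ∈ relativeCommutant D, ∀ x,
      E' (a * x * b) = a * E' x * b)
    -- `c` is the canonical positive invertible central element of `D`,
    -- `c = (∑ nⱼ²) ∑ⱼ (τ(pⱼ)/nⱼ²) pⱼ`, characterized by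
    -- `dim(D) · τ(d) = Tr_D(L_{cd})` for all `d ∈ D`, where `Tr_D` is the
    -- trace of left-multiplication operators on `D`
    (c cInv : M) (hcD : c ∈ D) (hcInvD : cInv ∈ D)
    (hcc : c * cInv = 1) (hcc' : cInv * c = 1)
    (hcstar : star c = c) (hccentral : ∀ d ∈ D, c * d = d * c)
    (hctrace : ∀ d : ↥D, (Module.finrank ℂ ↥D : ℂ) * τ (d : M) =
      LinearMap.trace ℂ ↥D (LinearMap.mulLeft ℂ ((⟨c, hcD⟩ : ↥D) * d)))
    (A₁ A₂ : Subalgebra ℂ M) (hDA₂ : D ≤ A₂)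
    (halgfree : AlgebraicallyFreeModulo ⊥ A₁ A₂ bot_le bot_le)
    (j₀ : M)
    (hj₀ : IsLiberationGradient τ τ (A₁ : Set M) (A₂ : Set M) j₀) :
    IsLiberationGradient τ ED ((A₁ ⊔ D : Subalgebra ℂ M) : Set M) (A₂ : Set M)
      ((Module.finrank ℂ ↥D : ℂ) • (E' j₀ * cInv)) := by
  obtain ⟨e, he⟩ := exists_isCasimirFamily hτ D hDstar (b := cInv)
    (by
      have h := congrArg star hcc
      rw [star_mul, hcstar, star_one] at h
      exact left_inv_eq_right_inv h hcc)
    (fun d hd => by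
      calc cInv * d = cInv * (d * c) * cInv := by rw [mul_assoc, mul_assoc, hcc, mul_one]
        _ = d * cInv := by rw [← hccentral d hd, ← mul_assoc, hcc', one_mul])
    (Module.finrank ℂ D) (fun d => by
      have h := hctrace (⟨cInv, hcInvD⟩ * d)
      have hd : (⟨c, hcD⟩ : D) * (⟨cInv, hcInvD⟩ * d) = d :=
        Subtype.ext (by simp [← mul_assoc, hcc])
      rw [hd] at h
      exact h)
  have hE' := he.condExp_commutant_eq hτ E' hE'mem hE'τ hE'bimod
  have hestar : ∀ i, star (e i) ∈ D := fun i => hDstar _ (he.mem i)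
  refine ⟨?_, ?_⟩
  · have hL : IsL2Bounded τ ((Module.finrank ℂ D : ℂ) • (LinearMap.mulRight ℂ cInv ∘ₗ
        ∑ i, LinearMap.mulRight ℂ (star (e i)) ∘ₗ LinearMap.mulLeft ℂ (e i))) :=
      ((he.isL2Bounded_mulRight hτ hcInvD).comp (hτ.isL2Bounded_sum _ _ fun i =>
        (he.isL2Bounded_mulRight hτ (hestar i)).comp
          (he.isL2Bounded_mulLeft hτ (he.mem i)))).smul _
    have hLx : ∀ x, ((Module.finrank ℂ D : ℂ) • (LinearMap.mulRight ℂ cInv ∘ₗ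
        ∑ i, LinearMap.mulRight ℂ (star (e i)) ∘ₗ LinearMap.mulLeft ℂ (e i))) x =
        (Module.finrank ℂ D : ℂ) • (E' x * cInv) := fun x => by
      simp [hE', Finset.sum_mul]
    have hsub : (A₁ : Set M) ∪ A₂ ⊆ ((A₁ ⊔ D : Subalgebra ℂ M) : Set M) ∪ A₂ :=
      Set.union_subset_union_left _ (le_sup_left (a := A₁) (b := D))
    have hDmem : ∀ d ∈ D, d ∈ Algebra.adjoin ℂ (((A₁ ⊔ D : Subalgebra ℂ M) : Set M) ∪ A₂ ∪
        star '' (((A₁ ⊔ D : Subalgebra ℂ M) : Set M) ∪ A₂)) := fun d hd =>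
      Algebra.subset_adjoin (Or.inl (Or.inr (hDA₂ hd)))
    rw [← hLx]
    refine hj₀.1.map hL fun a ha => ?_
    have ha' := Algebra.adjoin_mono (Set.union_subset_union hsub (Set.image_mono hsub)) ha
    rw [hLx, hE']
    exact Subalgebra.smul_mem _ (mul_mem (sum_mem fun i _ =>
      mul_mem (mul_mem (hDmem _ (he.mem i)) ha') (hDmem _ (hestar i))) (hDmem _ hcInvD)) _
  · rw [liberationEquations_iff]
    intro l hl
    set J : M := (Module.finrank ℂ D : ℂ) • (E' j₀ * cInv) with hJ
    obtain ⟨F, hF, hav⟩ :=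
      he.exists_isLiberationDeriv_listWord hτ hcInvD hED hEDτ hDA₂ j₀ l hl
    have hD0 : ∀ d ∈ D, IsLiberationDeriv τ (A₁ : Set M) (A₂ : Set M) j₀ d 0 := fun d hd =>
      .of_mem_right A₁.one_mem (hDA₂ hd)
    have hsandwich : ∀ f ∈ D, ∀ g ∈ D, τ (j₀ * (f * listWord l * g)) = F f g :=
      fun f hf g hg => by
        rw [(((hD0 f hf).mul hF).mul (hD0 g hg)).apply_eq hj₀.2]
        simp
    have hpair : ∀ d ∈ D, τ (ED (J * listWord l) * d) =
        τ (liberationSum (fun x y => ED x * ED y) l 1 1 * d) := fun d hd => by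
      rw [hED.apply_liberationSum_mul hτ hEDτ hd, one_mul, ← hav, averageForm,
        hED.apply_mul hEDτ hd, hJ, hE']
      simp only [smul_mul_assoc, map_smul, smul_eq_mul, Finset.sum_mul, map_sum, mul_one]
      congr 1
      refine Finset.sum_congr rfl fun i _ => ?_
      rw [← hsandwich _ (D.mul_mem (hestar i) hcInvD) _ (D.mul_mem hd (he.mem i))]
      simp only [mul_assoc]
      rw [hτ.tracial]
      simp only [mul_assoc]
    have hmem : ED (J * listWord l) - liberationSum (fun x y => ED x * ED y) l 1 1 ∈ D :=
      D.sub_mem (hED.2.1 _) (hED.liberationSum_mem l 1 1)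
    refine sub_eq_zero.mp (hτ.eq_zero_of_mul_star ?_)
    rw [sub_mul, map_sub, hpair _ (hDstar _ hmem), sub_self]

end OVD
end
end

section
/- Let (M, τ) be a tracial W*-probability space, B ⊂ M a unital *-subalgebra, and X_1,…,X_n ∈ M selfadjoint with Φ*(X_1,…,X_n : B) < ∞. Let D ⊂ B be a finite-dimensional unital subalgebra with a conditional expectation E: M → D such that τ∘E = τ. Then the following are equivalent: (i) E_{D'}( Σ_{i=1}^n [J_i(X_1,…,X_n : B), X_i] ) = 0; (ii) {X_1,…,X_n} is free from B with amalgamation over D. -/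
/-!  Statement 15 (Corollary 5.8):  for finite-dimensional `D ⊆ B` and `X₁,…,Xₙ` with finite `Φ*(X:B)` (conjugate system `J`), one has `E_{D′}(∑ᵢ [Jᵢ, Xᵢ]) = 0` iff `{X₁,…,Xₙ}` is free from `B` with amalgamation over `D`. -/

open scoped Classical ENNReal

noncomputable section

namespace OVD

variable {M : Type*} [Ring M] [Algebra ℂ M] [StarRing M] [StarModule ℂ M]

/-- Two subsets `S₁, S₂` of `A` (each thought of as a subalgebra containing the
base algebra) are free with amalgamation with respect to the conditional
expectation `E` (valued in the module `W`):  every alternating product of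
`E`-centered elements is `E`-centered. -/
def IsFreeWithAmalgamation {A W : Type*} [Ring A] [Algebra ℂ A]
    [AddCommGroup W] [Module ℂ W] (E : A →ₗ[ℂ] W) (S₁ S₂ : Set A) : Prop :=
  ∀ (k : ℕ), 0 < k → ∀ (a : Fin k → A) (f : Fin k → Bool),
    (∀ j, a j ∈ (if f j then S₁ else S₂)) →
    (∀ j, E (a j) = 0) →
    (∀ (j : ℕ) (h : j + 1 < k), f ⟨j, Nat.lt_of_succ_lt h⟩ ≠ f ⟨j + 1, h⟩) →
    E ((List.ofFn a).prod) = 0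

/-- the word `b₁ X_{i₁} b₂ X_{i₂} ⋯ b_m X_{i_m} b_{m+1}`. -/
def altWord {n : ℕ} (X : Fin n → M) {m : ℕ} (b : Fin (m + 1) → M)
    (idx : Fin m → Fin n) : M :=
  (List.ofFn fun j : Fin m => b j.castSucc * X (idx j)).prod * b (Fin.last m)

/-- the initial segment `b₁ X_{i₁} ⋯ b_{r-1} X_{i_{r-1}} b_r` of an
alternating word (`r` is `0`-indexed). -/
def altWordBefore {n : ℕ} (X : Fin n → M) {m : ℕ} (b : Fin (m + 1) → M)
    (idx : Fin m → Fin n) (r : Fin m) : M :=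
  (((List.finRange m).filter fun s : Fin m => decide ((s : ℕ) < (r : ℕ))).map
      fun j => b j.castSucc * X (idx j)).prod * b r.castSucc

/-- the final segment `b_{r+1} X_{i_{r+1}} ⋯ b_m X_{i_m} b_{m+1}` of an
alternating word (`r` is `0`-indexed). -/
def altWordAfter {n : ℕ} (X : Fin n → M) {m : ℕ} (b : Fin (m + 1) → M)
    (idx : Fin m → Fin n) (r : Fin m) : M :=
  (((List.finRange m).filter fun s : Fin m => decide ((r : ℕ) < (s : ℕ))).map
      fun j => b j.castSucc * X (idx j)).prod * b (Fin.last m)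

/-- the defining equations of the conjugate variables `J_i = J_i(X₁,…,Xₙ : B)`:
`τ(J_i b₁ X_{i₁} ⋯ b_m X_{i_m} b_{m+1}) = ∑_r δ_{i i_r} τ(b₁ X_{i₁} ⋯ b_r) ·
τ(b_{r+1} X_{i_{r+1}} ⋯ b_{m+1})` for all `m ≥ 0` and `b₁,…,b_{m+1} ∈ B`. -/
def ConjugateEquations (τ : M →ₗ[ℂ] ℂ) (B : Subalgebra ℂ M) {n : ℕ}
    (X J : Fin n → M) : Prop :=
  ∀ (i : Fin n) (m : ℕ) (b : Fin (m + 1) → M) (idx : Fin m → Fin n),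
    (∀ j, b j ∈ B) →
    τ (J i * altWord X b idx) =
      ∑ r : Fin m, (if idx r = i then (1 : ℂ) else 0) *
        τ (altWordBefore X b idx r) * τ (altWordAfter X b idx r)

/-- `J` is the system of conjugate variables of `X₁,…,Xₙ` with respect to `B`. -/
def IsConjugateSystem [StarRing M] (τ : M →ₗ[ℂ] ℂ) (B : Subalgebra ℂ M) {n : ℕ}
    (X J : Fin n → M) : Prop :=
  (∀ i, MemL2Closure τ ((B : Set M) ∪ Set.range X) (J i)) ∧
    ConjugateEquations τ B X J

/-- the relative free Fisher information `Φ*(X₁,…,Xₙ : B)`; it equals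
`∑ᵢ ‖Jᵢ‖₂²` if a conjugate system `J` exists and `∞` otherwise. -/
def phiStar [StarRing M] (τ : M →ₗ[ℂ] ℂ) (B : Subalgebra ℂ M) {n : ℕ}
    (X : Fin n → M) : ℝ≥0∞ :=
  sInf {r : ℝ≥0∞ | ∃ J : Fin n → M, IsConjugateSystem τ B X J ∧
    r = ∑ i, ENNReal.ofReal ((τ (J i * star (J i))).re)}

section WordCalculus

variable {A : Type*} [Ring A]

/-- The product of a word whose letters carry a Boolean label. -/
def wordVal (l : List (Bool × A)) : A := (l.map Prod.snd).prod

@[simp] theorem wordVal_nil : wordVal ([] : List (Bool × A)) = 1 := rfl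

@[simp] theorem wordVal_cons (x : Bool × A) (l : List (Bool × A)) :
    wordVal (x :: l) = x.2 * wordVal l := by simp [wordVal]

@[simp] theorem wordVal_append (u v : List (Bool × A)) :
    wordVal (u ++ v) = wordVal u * wordVal v := by simp [wordVal]

variable [Algebra ℂ A]

/-- The value `ψ(p · δ(l) · s)`, where `δ` is the derivation with `δ a = a ⊗ 1 - 1 ⊗ a` on the
letters labelled `true` and `δ b = 0` on the letters labelled `false`. -/
def libPairing (ψ : A →ₗ[ℂ] A →ₗ[ℂ] ℂ) : A → List (Bool × A) → A → ℂ
  | _, [], _ => 0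
  | p, x :: l, s =>
    (if x.1 then ψ (p * x.2) (wordVal l * s) - ψ p (x.2 * wordVal l * s) else 0) +
      libPairing ψ (p * x.2) l s

variable (ψ : A →ₗ[ℂ] A →ₗ[ℂ] ℂ)

@[simp] theorem libPairing_nil (p s : A) : libPairing ψ p [] s = 0 := rfl

theorem libPairing_cons (p : A) (x : Bool × A) (l : List (Bool × A)) (s : A) :
    libPairing ψ p (x :: l) s =
      (if x.1 then ψ (p * x.2) (wordVal l * s) - ψ p (x.2 * wordVal l * s) else 0) +
        libPairing ψ (p * x.2) l s := rfl

theorem libPairing_append (p : A) (u v : List (Bool × A)) (s : A) :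
    libPairing ψ p (u ++ v) s =
      libPairing ψ p u (wordVal v * s) + libPairing ψ (p * wordVal u) v s := by
  induction u generalizing p with
  | nil => simp
  | cons x u ih => simp [libPairing_cons, ih, mul_assoc, add_assoc]

theorem libPairing_add_left (p q : A) (l : List (Bool × A)) (s : A) :
    libPairing ψ (p + q) l s = libPairing ψ p l s + libPairing ψ q l s := by
  induction l generalizing p q with
  | nil => simp
  | cons x l ih =>
    simp only [libPairing_cons, add_mul, ih, map_add, LinearMap.add_apply]
    split_ifs <;> ring

theorem libPairing_add_right (p : A) (l : List (Bool × A)) (s t : A) :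
    libPairing ψ p l (s + t) = libPairing ψ p l s + libPairing ψ p l t := by
  induction l generalizing p with
  | nil => simp
  | cons x l ih =>
    simp only [libPairing_cons, mul_add, ih, map_add]
    split_ifs <;> ring

theorem libPairing_congr_middle {m m' : List (Bool × A)} (hval : wordVal m = wordVal m')
    (h : ∀ p s, libPairing ψ p m s = libPairing ψ p m' s) (p : A) (u v : List (Bool × A)) (s : A) :
    libPairing ψ p (u ++ (m ++ v)) s = libPairing ψ p (u ++ (m' ++ v)) s := by
  simp only [libPairing_append, wordVal_append, hval, h]

theorem libPairing_merge (p : A) (u v : List (Bool × A)) (f : Bool) (x y s : A) :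
    libPairing ψ p (u ++ (f, x) :: (f, y) :: v) s = libPairing ψ p (u ++ (f, x * y) :: v) s := by
  refine libPairing_congr_middle ψ (m := [(f, x), (f, y)]) (m' := [(f, x * y)]) (by simp) ?_ p u v s
  intro p s
  cases f <;> simp [libPairing_cons, mul_assoc]

theorem libPairing_add_letter (p : A) (u v : List (Bool × A)) (f : Bool) (x y s : A) :
    libPairing ψ p (u ++ (f, x + y) :: v) s =
      libPairing ψ p (u ++ (f, x) :: v) s + libPairing ψ p (u ++ (f, y) :: v) s := by
  simp only [libPairing_append, libPairing_cons, wordVal_cons, mul_add, add_mul,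
    libPairing_add_left, libPairing_add_right, map_add, LinearMap.add_apply]
  split_ifs <;> ring

theorem libPairing_relabel (D : Subalgebra ℂ A) (hψ : ∀ x y, ∀ d ∈ D, ψ (x * d) y = ψ x (d * y))
    (p : A) (u v : List (Bool × A)) (f g : Bool) {d : A} (hd : d ∈ D) (s : A) :
    libPairing ψ p (u ++ (f, d) :: v) s = libPairing ψ p (u ++ (g, d) :: v) s := by
  refine libPairing_congr_middle ψ (m := [(f, d)]) (m' := [(g, d)]) (by simp) ?_ p u v s
  intro p s
  cases f <;> cases g <;> simp [libPairing_cons, hψ _ _ d hd]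

theorem libPairing_eq_sum {ι : Type*} [Fintype ι] (φ : A →ₗ[ℂ] A →ₗ[ℂ] ℂ) (e e' : ι → A)
    (h : ∀ x y, ψ x y = ∑ i, φ (e i * x) (y * e' i)) (p : A) (l : List (Bool × A)) (s : A) :
    libPairing ψ p l s = ∑ i, libPairing φ (e i * p) l (s * e' i) := by
  induction l generalizing p with
  | nil => simp
  | cons x l ih =>
    simp only [libPairing_cons, ih, h, Finset.sum_add_distrib, mul_assoc]
    split_ifs <;> simp

theorem libPairing_of_split_eq_zero (p : A) (x : Bool × A) (l : List (Bool × A))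
    (h : ∀ u v, u ≠ [] → v ≠ [] → x :: l = u ++ v → ψ (p * wordVal u) (wordVal v) = 0) :
    libPairing ψ p (x :: l) 1 =
      (if ((x :: l).getLast (List.cons_ne_nil x l)).1 then ψ (p * wordVal (x :: l)) 1 else 0) -
        (if x.1 then ψ p (wordVal (x :: l)) else 0) := by
  induction l generalizing p x with
  | nil => rw [libPairing_cons]; split_ifs <;> simp_all
  | cons y l ih =>
    rw [libPairing_cons, ih]
    · have h0 := h [x] (y :: l) (by simp) (by simp) rfl
      simp only [wordVal_cons, wordVal_nil, mul_one] at h0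
      simp only [List.getLast_cons_cons, wordVal_cons, mul_one, h0, mul_assoc]
      split_ifs <;> ring
    · intro u v hu hv huv
      have := h (x :: u) v (by simp) hv (by simp [huv])
      simpa [mul_assoc] using this

end WordCalculus

section Freeness

variable {A : Type*} [Ring A] [Algebra ℂ A]

/-- An alternating word of centred letters taken from `S₁` (label `true`) and `S₂`
(label `false`). -/
structure IsReducedWord (E : A →ₗ[ℂ] A) (S₁ S₂ : Set A) (l : List (Bool × A)) : Prop where
  mem : ∀ x ∈ l, x.2 ∈ if x.1 then S₁ else S₂
  centred : ∀ x ∈ l, E x.2 = 0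
  chain : l.IsChain fun x y => x.1 ≠ y.1

variable {E : A →ₗ[ℂ] A} {S₁ S₂ : Set A}

theorem IsReducedWord.left {u v : List (Bool × A)} (h : IsReducedWord E S₁ S₂ (u ++ v)) :
    IsReducedWord E S₁ S₂ u :=
  ⟨fun x hx => h.mem x (by simp [hx]), fun x hx => h.centred x (by simp [hx]),
    h.chain.left_of_append⟩

theorem IsReducedWord.right {u v : List (Bool × A)} (h : IsReducedWord E S₁ S₂ (u ++ v)) :
    IsReducedWord E S₁ S₂ v :=
  ⟨fun x hx => h.mem x (by simp [hx]), fun x hx => h.centred x (by simp [hx]),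
    h.chain.right_of_append⟩

theorem isFreeWithAmalgamation_iff_isReducedWord :
    IsFreeWithAmalgamation E S₁ S₂ ↔
      ∀ l, l ≠ [] → IsReducedWord E S₁ S₂ l → E (wordVal l) = 0 := by
  constructor
  · intro h l hl hr
    have := h l.length (List.length_pos_iff.2 hl) (fun j => l[j].2) (fun j => l[j].1)
      (fun j => hr.mem _ (by simp)) (fun j => hr.centred _ (by simp))
      (fun j hj => List.isChain_iff_getElem.1 hr.chain j hj)
    convert this
    rw [wordVal]
    congr 1
    apply List.ext_getElem <;> simp
  · intro h k hk a f hmem hcen hchain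
    have := h (List.ofFn fun j => (f j, a j)) (by simp [List.ofFn_eq_nil_iff]; omega)
      ⟨by simpa [List.mem_ofFn] using hmem, by simpa [List.mem_ofFn] using hcen, by
        rw [List.isChain_iff_getElem]
        intro i hi
        simpa using hchain i (by simpa using hi)⟩
    rw [wordVal, List.map_ofFn] at this
    exact this

end Freeness

section Amalgamation

variable {A : Type*} [Ring A] [Algebra ℂ A] {E : A →ₗ[ℂ] A} {D P Q : Subalgebra ℂ A}

theorem IsCondExp.map_mul_left (hE : IsCondExp D E) {d : A} (hd : d ∈ D) (x : A) :
    E (d * x) = d * E x := by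
  simpa using hE.2.2 d hd 1 D.one_mem x

theorem IsCondExp.map_mul_right (hE : IsCondExp D E) {d : A} (hd : d ∈ D) (x : A) :
    E (x * d) = E x * d := by
  simpa using hE.2.2 1 D.one_mem d hd x

theorem IsCondExp.map_of_mem (hE : IsCondExp D E) {d : A} (hd : d ∈ D) : E d = d := by
  simpa [hE.1] using hE.map_mul_left hd 1

theorem IsCondExp.map_sub_self (hE : IsCondExp D E) (x : A) : E (x - E x) = 0 := by
  rw [map_sub, hE.map_of_mem (hE.2.1 x), sub_self]

theorem IsReducedWord.cons_of_label {x y : Bool × A} {l : List (Bool × A)} {S₁ S₂ : Set A}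
    (h : IsReducedWord E S₁ S₂ (x :: l)) (hlabel : y.1 = x.1)
    (hmem : y.2 ∈ if y.1 then S₁ else S₂) (hy : E y.2 = 0) : IsReducedWord E S₁ S₂ (y :: l) := by
  refine ⟨?_, ?_, ?_⟩
  · exact List.forall_mem_cons.2 ⟨hmem, fun a ha => h.mem a (List.mem_cons_of_mem _ ha)⟩
  · exact List.forall_mem_cons.2 ⟨hy, fun a ha => h.centred a (List.mem_cons_of_mem _ ha)⟩
  · have := h.chain
    rw [List.isChain_cons] at this ⊢
    rw [hlabel]
    exact this

theorem IsReducedWord.mul_left (hE : IsCondExp D E) (hP : D ≤ P) (hQ : D ≤ Q) {d : A} (hd : d ∈ D)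
    {x : Bool × A} {l : List (Bool × A)} (h : IsReducedWord E (P : Set A) (Q : Set A) (x :: l)) :
    IsReducedWord E (P : Set A) (Q : Set A) ((x.1, d * x.2) :: l) := by
  refine h.cons_of_label rfl ?_ ?_
  · have := h.mem x (by simp)
    rcases x with ⟨_ | _, x⟩
    · exact Q.mul_mem (hQ hd) (by simpa using this)
    · exact P.mul_mem (hP hd) (by simpa using this)
  · rw [hE.map_mul_left hd, h.centred x (by simp), mul_zero]

/-- The bilinear form `(x, y) ↦ τ(E(x) y)`. -/
def condPairing (τ : A →ₗ[ℂ] ℂ) (E : A →ₗ[ℂ] A) : A →ₗ[ℂ] A →ₗ[ℂ] ℂ :=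
  (LinearMap.mul ℂ A).compr₂ τ ∘ₗ E

@[simp] theorem condPairing_apply (τ : A →ₗ[ℂ] ℂ) (E : A →ₗ[ℂ] A) (x y : A) :
    condPairing τ E x y = τ (E x * y) := rfl

variable {τ : A →ₗ[ℂ] ℂ}

theorem condPairing_balanced (hE : IsCondExp D E) (x y : A) :
    ∀ d ∈ D, condPairing τ E (x * d) y = condPairing τ E x (d * y) := by
  intro d hd
  simp [hE.map_mul_right hd, mul_assoc]

theorem isReducedWord_trace_eq_zero (hE : IsCondExp D E) (hP : D ≤ P) (hQ : D ≤ Q)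
    (hEτ : ∀ x, τ (E x) = τ x) (hτ : ∀ x y, τ (x * y) = τ (y * x))
    (hpair : ∀ l : List (Bool × A), (∀ x ∈ l, x.2 ∈ if x.1 then (P : Set A) else Q) →
      libPairing (condPairing τ E) 1 l 1 = 0)
    (x : Bool × A) (l : List (Bool × A)) (hl : IsReducedWord E (P : Set A) (Q : Set A) (x :: l))
    (ih : ∀ u, u ≠ [] → u.length < (x :: l).length → IsReducedWord E (P : Set A) (Q : Set A) u →
      E (wordVal u) = 0) :
    τ (wordVal (x :: l)) = 0 := by
  rcases List.eq_nil_or_concat l with rfl | ⟨m, y, rfl⟩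
  · rw [← hEτ]
    simp [hl.centred x (by simp)]
  · by_cases hxy : x.1 = y.1
    · have hm : m ≠ [] := by
        rintro rfl
        have := hl.chain
        simp_all
      obtain ⟨z, m, rfl⟩ := List.exists_cons_of_ne_nil hm
      rw [List.concat_eq_append] at hl ih ⊢
      have hlm : IsReducedWord E (P : Set A) (Q : Set A) (x :: z :: m) :=
        hl.left (u := x :: z :: m) (v := [y])
      set q := y.2 * x.2 with hq
      have hqP : q ∈ if x.1 then (P : Set A) else Q := by
        have h1 := hl.mem x (by simp)
        have h2 := hl.mem y (by simp)
        rw [← hxy] at h2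
        split_ifs at * with hx
        · exact P.mul_mem h2 h1
        · exact Q.mul_mem h2 h1
      have hEq : E q ∈ if x.1 then (P : Set A) else Q := by
        split_ifs
        · exact hP (hE.2.1 q)
        · exact hQ (hE.2.1 q)
      have h1 : E (wordVal ((x.1, q - E q) :: z :: m)) = 0 := by
        refine ih _ (by simp) (by simp) (hlm.cons_of_label rfl ?_ (hE.map_sub_self q))
        show q - E q ∈ if x.1 then (P : Set A) else Q
        split_ifs at *
        · exact P.sub_mem hqP hEq
        · exact Q.sub_mem hqP hEq
      have h2 : E (wordVal (z :: m)) = 0 :=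
        ih _ (by simp) (by simp) (IsReducedWord.right (u := [x]) hlm)
      have h3 : E (E q * wordVal (z :: m)) = 0 := by
        rw [hE.map_mul_left (hE.2.1 q), h2, mul_zero]
      calc τ (wordVal (x :: (z :: m ++ [y])))
          = τ (wordVal ((x.1, q - E q) :: z :: m) + E q * wordVal (z :: m)) := by
            rw [wordVal_cons, wordVal_append, ← mul_assoc, hτ]
            simp [hq, sub_mul, mul_assoc]
        _ = 0 := by rw [← hEτ, map_add, h1, h3, add_zero, map_zero]
    · have h := hpair _ hl.mem
      rw [libPairing_of_split_eq_zero] at h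
      · have hlast : (x :: m.concat y).getLast (List.cons_ne_nil _ _) = y := by simp
        rw [hlast] at h
        simp only [condPairing_apply, one_mul, mul_one, hE.1, hEτ] at h
        rcases x with ⟨_ | _, x⟩ <;> rcases y with ⟨_ | _, y⟩ <;> simp_all
      · intro u v hu hv huv
        rw [huv] at hl
        simp [ih u hu (by rw [huv]; simp [List.length_pos_iff.2 hv]) hl.left]

theorem isFreeWithAmalgamation_of_libPairing_eq_zero (hE : IsCondExp D E) (hP : D ≤ P) (hQ : D ≤ Q)
    (hEτ : ∀ x, τ (E x) = τ x) (hτ : ∀ x y, τ (x * y) = τ (y * x))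
    (hfaithful : ∀ d ∈ D, (∀ d' ∈ D, τ (d' * d) = 0) → d = 0)
    (hpair : ∀ l : List (Bool × A), (∀ x ∈ l, x.2 ∈ if x.1 then (P : Set A) else Q) →
      libPairing (condPairing τ E) 1 l 1 = 0) :
    IsFreeWithAmalgamation E (P : Set A) (Q : Set A) := by
  rw [isFreeWithAmalgamation_iff_isReducedWord]
  intro l
  induction hk : l.length using Nat.strong_induction_on generalizing l with
  | _ k ih =>
    subst hk
    intro hl hr
    obtain ⟨x, l, rfl⟩ := List.exists_cons_of_ne_nil hl
    refine hfaithful _ (hE.2.1 _) fun d hd => ?_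
    rw [← hE.map_mul_left hd, hEτ]
    have := isReducedWord_trace_eq_zero hE hP hQ hEτ hτ hpair _ _ (hr.mul_left hE hP hQ hd)
      fun u hu hlen hru => ih u.length (by simpa using hlen) u rfl hu hru
    simpa [mul_assoc] using this

theorem libPairing_reduced_append_eq_zero (hE : IsCondExp D E) (hP : D ≤ P) (hQ : D ≤ Q)
    (hEτ : ∀ x, τ (E x) = τ x)
    (hfree : IsFreeWithAmalgamation E (P : Set A) (Q : Set A)) (k : ℕ)
    (ih : ∀ l : List (Bool × A), l.length < k →
      (∀ x ∈ l, x.2 ∈ if x.1 then (P : Set A) else Q) →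
      libPairing (condPairing τ E) 1 l 1 = 0)
    (u v : List (Bool × A)) (hk : (u ++ v).length = k)
    (hu : IsReducedWord E (P : Set A) (Q : Set A) u)
    (hv : ∀ x ∈ v, x.2 ∈ if x.1 then (P : Set A) else Q) :
    libPairing (condPairing τ E) 1 (u ++ v) 1 = 0 := by
  rw [isFreeWithAmalgamation_iff_isReducedWord] at hfree
  induction v generalizing u with
  | nil =>
    rcases u with _ | ⟨x, l⟩
    · simp
    · rw [List.append_nil, libPairing_of_split_eq_zero]
      · have h0 : τ (wordVal (x :: l)) = 0 := by
          rw [← hEτ, hfree _ (by simp) hu, map_zero]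
        simp only [condPairing_apply, one_mul, mul_one, hE.1, hEτ, h0, ite_self, sub_zero]
      · intro p q hp hq hpq
        rw [hpq] at hu
        simp [hfree p hp hu.left]
  | cons x v IH =>
    obtain ⟨f, x⟩ := x
    have hx : x ∈ if f then (P : Set A) else Q := hv (f, x) (by simp)
    have hv' := fun y hy => hv y (List.mem_cons_of_mem (f, x) hy)
    have hDmem : ∀ {d}, d ∈ D → ∀ g : Bool, d ∈ if g then (P : Set A) else Q := by
      intro d hd g
      split_ifs
      exacts [hP hd, hQ hd]
    have hmul : ∀ {a b} {g : Bool}, a ∈ (if g then (P : Set A) else Q) →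
        b ∈ (if g then (P : Set A) else Q) → a * b ∈ if g then (P : Set A) else Q := by
      intro a b g ha hb
      cases g
      exacts [Q.mul_mem ha hb, P.mul_mem ha hb]
    have hz : x - E x ∈ if f then (P : Set A) else Q := by
      have hd := hDmem (hE.2.1 x) f
      cases f
      exacts [Q.sub_mem hx hd, P.sub_mem hx hd]
    have hsplit : ∀ w, libPairing (condPairing τ E) 1 (w ++ (f, x) :: v) 1 =
        libPairing (condPairing τ E) 1 ((w ++ [(f, x - E x)]) ++ v) 1 +
          libPairing (condPairing τ E) 1 (w ++ (f, E x) :: v) 1 := by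
      intro w
      rw [List.append_assoc, List.singleton_append, ← libPairing_add_letter, sub_add_cancel]
    have hrelabel := libPairing_relabel (condPairing τ E) D (condPairing_balanced hE) 1
    rcases List.eq_nil_or_concat u with rfl | ⟨w, y, rfl⟩
    · rw [hsplit, List.nil_append, IH [(f, x - E x)] (by simpa using hk) ⟨by simpa using hz, by
        simpa using hE.map_sub_self x, by simp⟩ hv', zero_add]
      rcases v with _ | ⟨⟨g, y⟩, v⟩
      · simp [libPairing_cons, hE.1, hEτ]
      · rw [hrelabel _ _ f g (hE.2.1 x), libPairing_merge]
        refine ih _ (by simp at hk; simp; omega) ?_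
        rw [List.nil_append, List.forall_mem_cons]
        exact ⟨hmul (hDmem (hE.2.1 x) g) (hv' (g, y) (by simp)),
          fun a ha => hv' a (List.mem_cons_of_mem _ ha)⟩
    · obtain ⟨g, y⟩ := y
      rw [List.concat_eq_append] at hu hk ⊢
      have hmerge : ∀ b ∈ (if g then (P : Set A) else Q),
          libPairing (condPairing τ E) 1 (w ++ [(g, y)] ++ (g, b) :: v) 1 = 0 := by
        intro b hb
        rw [List.append_assoc, List.singleton_append, libPairing_merge]
        refine ih _ (by simp at hk; simp; omega) ?_
        rw [List.forall_mem_append, List.forall_mem_cons]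
        exact ⟨fun a ha => hu.mem a (by simp [ha]),
          hmul (hu.mem (g, y) (by simp)) hb, hv'⟩
      by_cases hgf : g = f
      · subst hgf
        exact hmerge x hx
      · rw [hsplit, hrelabel _ _ f g (hE.2.1 x), hmerge _ (hDmem (hE.2.1 x) g), add_zero]
        refine IH _ (by simpa [add_assoc, add_comm, add_left_comm] using hk) ⟨?_, ?_, ?_⟩ hv'
        · rw [List.forall_mem_append]
          exact ⟨hu.mem, by simpa using hz⟩
        · rw [List.forall_mem_append]
          exact ⟨hu.centred, by simpa using hE.map_sub_self x⟩
        · rw [List.isChain_append]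
          exact ⟨hu.chain, by simp, by simpa using hgf⟩

theorem libPairing_eq_zero_of_isFreeWithAmalgamation (hE : IsCondExp D E) (hP : D ≤ P)
    (hQ : D ≤ Q) (hEτ : ∀ x, τ (E x) = τ x)
    (hfree : IsFreeWithAmalgamation E (P : Set A) (Q : Set A)) (l : List (Bool × A))
    (hl : ∀ x ∈ l, x.2 ∈ if x.1 then (P : Set A) else Q) :
    libPairing (condPairing τ E) 1 l 1 = 0 := by
  induction hk : l.length using Nat.strong_induction_on generalizing l with
  | _ k ih =>
    exact libPairing_reduced_append_eq_zero hE hP hQ hEτ hfree k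
      (fun l hlen hl => ih l.length hlen l hl rfl) [] l hk ⟨by simp, by simp, by simp⟩ hl

theorem libPairing_eq_zero_of_generators (hE : IsCondExp D E) (hQ : D ≤ Q) (S : Set A)
    (hgen : ∀ l : List (Bool × A), (∀ x ∈ l, x.2 ∈ if x.1 then S else (Q : Set A)) →
      libPairing (condPairing τ E) 1 l 1 = 0)
    (l : List (Bool × A))
    (hl : ∀ x ∈ l, x.2 ∈ if x.1 then ((D ⊔ Algebra.adjoin ℂ S : Subalgebra ℂ A) : Set A) else Q) :
    libPairing (condPairing τ E) 1 l 1 = 0 := by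
  set good : List (Bool × A) → Prop := fun v => ∀ u : List (Bool × A),
    (∀ x ∈ u, x.2 ∈ if x.1 then S else (Q : Set A)) →
      libPairing (condPairing τ E) 1 (u ++ v) 1 = 0 with hgood
  have hcons : ∀ (x : Bool × A), (x.2 ∈ if x.1 then S else (Q : Set A)) → ∀ v, good v →
      good (x :: v) := by
    intro x hx v hv u hu
    have := hv (u ++ [x]) (by
      rw [List.forall_mem_append]
      exact ⟨hu, by simpa using hx⟩)
    simpa using this
  have hadjoin : D ⊔ Algebra.adjoin ℂ S = Algebra.adjoin ℂ ((D : Set A) ∪ S) := by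
    rw [Algebra.adjoin_union, Algebra.adjoin_eq]
  have hconst : ∀ d ∈ D, ∀ v, good v → good ((true, d) :: v) := by
    intro d hd v hv u hu
    rw [libPairing_relabel (condPairing τ E) D (condPairing_balanced hE) 1 _ _ true false hd]
    exact hcons (false, d) (hQ hd) v hv u hu
  have htrue : ∀ a ∈ Algebra.adjoin ℂ ((D : Set A) ∪ S), ∀ v, good v → good ((true, a) :: v) := by
    intro a ha
    induction ha using Algebra.adjoin_induction with
    | mem a ha =>
      rcases ha with ha | ha
      · exact hconst a ha
      · exact hcons (true, a) (by simpa using ha)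
    | algebraMap r => exact hconst _ (D.algebraMap_mem r)
    | add a b _ _ iha ihb =>
      intro v hv u hu
      rw [libPairing_add_letter, iha v hv u hu, ihb v hv u hu, add_zero]
    | mul a b _ _ iha ihb =>
      intro v hv u hu
      rw [← libPairing_merge]
      exact iha _ (ihb v hv) u hu
  have hall : good l := by
    induction l with
    | nil =>
      intro u hu
      simpa using hgen u hu
    | cons x l ih =>
      obtain ⟨hx, hl'⟩ := List.forall_mem_cons.1 hl
      obtain ⟨_ | _, x⟩ := x
      · exact hcons _ hx _ (ih hl')
      · exact htrue x (by simpa [hadjoin] using hx) _ (ih hl')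
  simpa using hall [] (by simp)

end Amalgamation

section ConjugateVariables

section AltWord

variable {A : Type*} [Ring A] {n : ℕ} {X : Fin n → A}

theorem altWord_succ {m : ℕ} (b : Fin (m + 2) → A) (idx : Fin (m + 1) → Fin n) :
    altWord X b idx =
      b 0 * X (idx 0) * altWord X (fun j => b j.succ) (fun j => idx j.succ) := by
  simp [altWord, List.ofFn_succ, mul_assoc]

theorem altWordBefore_zero {m : ℕ} (b : Fin (m + 2) → A) (idx : Fin (m + 1) → Fin n) :
    altWordBefore X b idx 0 = b 0 := by
  simp [altWordBefore]

theorem altWordAfter_zero {m : ℕ} (b : Fin (m + 2) → A) (idx : Fin (m + 1) → Fin n) :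
    altWordAfter X b idx 0 = altWord X (fun j => b j.succ) (fun j => idx j.succ) := by
  simp [altWordAfter, altWord, List.finRange_succ, List.filter_map, Function.comp_def,
    List.ofFn_eq_map]

theorem altWordBefore_succ {m : ℕ} (b : Fin (m + 2) → A) (idx : Fin (m + 1) → Fin n) (r : Fin m) :
    altWordBefore X b idx r.succ =
      b 0 * X (idx 0) * altWordBefore X (fun j => b j.succ) (fun j => idx j.succ) r := by
  simp [altWordBefore, List.finRange_succ, List.filter_map, Function.comp_def, mul_assoc]

theorem altWordAfter_succ {m : ℕ} (b : Fin (m + 2) → A) (idx : Fin (m + 1) → Fin n) (r : Fin m) :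
    altWordAfter X b idx r.succ =
      altWordAfter X (fun j => b j.succ) (fun j => idx j.succ) r := by
  simp [altWordAfter, List.finRange_succ, List.filter_map, Function.comp_def]

end AltWord

variable {A : Type*} [Ring A] [Algebra ℂ A] {n : ℕ} (X : Fin n → A) (B : Subalgebra ℂ A)

/-- A generator `Xᵢ` is labelled `true`, an element of `B` is labelled `false`. -/
def letter : Fin n ⊕ B → Bool × A
  | .inl i => (true, X i)
  | .inr b => (false, b)

@[simp] theorem letter_inl (i : Fin n) : letter X B (.inl i) = (true, X i) := rfl

@[simp] theorem letter_inr (b : B) : letter X B (.inr b) = (false, (b : A)) := rfl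

/-- The value `(τ ⊗ τ)(p · ∂ᵢ(l) · s)` of the free difference quotient `∂ᵢ` on a word. -/
def conjPairing (τ : A →ₗ[ℂ] ℂ) (i : Fin n) : A → List (Fin n ⊕ B) → A → ℂ
  | _, [], _ => 0
  | p, .inl k :: l, s =>
    (if k = i then τ p * τ (wordVal (l.map (letter X B)) * s) else 0) +
      conjPairing τ i (p * X k) l s
  | p, .inr b :: l, s => conjPairing τ i (p * b) l s

/-- The list of letters of the word `b₁ X_{i₁} ⋯ b_m X_{i_m} b_{m+1}`. -/
def interleave : (m : ℕ) → (Fin (m + 1) → B) → (Fin m → Fin n) → List (Fin n ⊕ B)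
  | 0, b, _ => [.inr (b 0)]
  | m + 1, b, idx =>
    .inr (b 0) :: .inl (idx 0) :: interleave m (fun j => b j.succ) (fun j => idx j.succ)

variable {X B} {τ : A →ₗ[ℂ] ℂ}

theorem wordVal_interleave (m : ℕ) (b : Fin (m + 1) → B) (idx : Fin m → Fin n) :
    wordVal ((interleave B m b idx).map (letter X B)) = altWord X (fun j => (b j : A)) idx := by
  induction m with
  | zero => simp [interleave, altWord]
  | succ m ih => simp [interleave, ih, altWord_succ, mul_assoc]

theorem conjPairing_interleave (i : Fin n) (m : ℕ) (b : Fin (m + 1) → B) (idx : Fin m → Fin n)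
    (p : A) :
    conjPairing X B τ i p (interleave B m b idx) 1 =
      ∑ r : Fin m, (if idx r = i then (1 : ℂ) else 0) *
        τ (p * altWordBefore X (fun j => (b j : A)) idx r) *
          τ (altWordAfter X (fun j => (b j : A)) idx r) := by
  induction m generalizing p with
  | zero => simp [interleave, conjPairing]
  | succ m ih =>
    rw [Fin.sum_univ_succ]
    simp [interleave, conjPairing, ih, wordVal_interleave, altWordBefore_zero, altWordAfter_zero,
      altWordBefore_succ, altWordAfter_succ, mul_assoc]

theorem exists_interleave (l : List (Fin n ⊕ B)) :
    ∃ (m : ℕ) (b : Fin (m + 1) → B) (idx : Fin m → Fin n),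
      wordVal (l.map (letter X B)) = wordVal ((interleave B m b idx).map (letter X B)) ∧
      ∀ τ : A →ₗ[ℂ] ℂ, ∀ i p s,
        conjPairing X B τ i p l s = conjPairing X B τ i p (interleave B m b idx) s := by
  induction l with
  | nil => exact ⟨0, fun _ => 1, Fin.elim0, by simp [interleave], by simp [interleave, conjPairing]⟩
  | cons x l ih =>
    obtain ⟨m, b, idx, hval, hpair⟩ := ih
    rcases x with k | a
    · exact ⟨m + 1, Fin.cons 1 b, Fin.cons k idx, by simp [interleave, hval],
        by simp [interleave, conjPairing, hval, hpair]⟩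
    · refine ⟨m, Fin.cons (a * b 0) fun j => b j.succ, idx, ?_, ?_⟩
      · cases m <;> simp [interleave, hval, mul_assoc]
      · cases m <;> simp [interleave, conjPairing, hpair, mul_assoc]

theorem ConjugateEquations.apply_word {J : Fin n → A} (hJ : ConjugateEquations τ B X J) (i : Fin n)
    (l : List (Fin n ⊕ B)) :
    τ (J i * wordVal (l.map (letter X B))) = conjPairing X B τ i 1 l 1 := by
  obtain ⟨m, b, idx, hval, hpair⟩ := exists_interleave (X := X) l
  rw [hval, hpair, wordVal_interleave, hJ i m _ idx fun j => (b j).2, conjPairing_interleave]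
  simp

theorem conjPairing_append (i : Fin n) (p : A) (u v : List (Fin n ⊕ B)) (s : A) :
    conjPairing X B τ i p (u ++ v) s =
      conjPairing X B τ i p u (wordVal (v.map (letter X B)) * s) +
        conjPairing X B τ i (p * wordVal (u.map (letter X B))) v s := by
  induction u generalizing p with
  | nil => simp [conjPairing]
  | cons x u ih =>
    rcases x with k | b
    · simp [conjPairing, ih, mul_assoc, add_assoc]
    · simp [conjPairing, ih, mul_assoc]

/-- The bilinear form `(x, y) ↦ τ(x) τ(y)`. -/
def prodPairing (τ : A →ₗ[ℂ] ℂ) : A →ₗ[ℂ] A →ₗ[ℂ] ℂ :=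
  (LinearMap.mul ℂ ℂ).compl₁₂ τ τ

@[simp] theorem prodPairing_apply (x y : A) : prodPairing τ x y = τ x * τ y := rfl

theorem sum_conjPairing_sub (hτ : ∀ x y, τ (x * y) = τ (y * x)) (p : A) (l : List (Fin n ⊕ B))
    (s : A) :
    ∑ i, (conjPairing X B τ i (X i * p) l s - conjPairing X B τ i p l (s * X i)) =
      libPairing (prodPairing τ) p (l.map (letter X B)) s := by
  induction l generalizing p with
  | nil => simp [conjPairing]
  | cons x l ih =>
    rcases x with k | b
    · have h := ih (p * X k)
      simp only [← mul_assoc] at h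
      simp only [conjPairing, List.map_cons, letter_inl, libPairing_cons, prodPairing_apply,
        ← h, if_true, add_sub_add_comm, Finset.sum_add_distrib, ← mul_assoc]
      congr 1
      simp only [Finset.sum_sub_distrib, Finset.sum_ite_eq, Finset.mem_univ, if_true]
      rw [hτ (X k) p, hτ (_ * s) (X k), mul_assoc]
    · have h := ih (p * b)
      simp only [← mul_assoc] at h
      simp [conjPairing, libPairing_cons, ← h, mul_assoc]

theorem ConjugateEquations.sum_commutator_apply {J : Fin n → A} (hJ : ConjugateEquations τ B X J)
    (hτ : ∀ x y, τ (x * y) = τ (y * x)) (hτ1 : τ 1 = 1) (l : List (Fin n ⊕ B)) :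
    τ ((∑ i, (J i * X i - X i * J i)) * wordVal (l.map (letter X B))) =
      libPairing (prodPairing τ) 1 (l.map (letter X B)) 1 := by
  rw [← sum_conjPairing_sub hτ, Finset.sum_mul, map_sum]
  refine Finset.sum_congr rfl fun i _ => ?_
  have h1 := hJ.apply_word i (.inl i :: l)
  have h2 := hJ.apply_word i (l ++ [.inl i])
  rw [conjPairing_append] at h2
  simp only [conjPairing, List.map_cons, letter_inl, wordVal_cons, if_true, hτ1, one_mul, mul_one,
    List.map_append, List.map_nil, wordVal_append, wordVal_nil, add_zero] at h1 h2 ⊢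
  rw [sub_mul, map_sub, mul_assoc, h1, mul_assoc, hτ (X i), mul_assoc, h2]
  ring

end ConjugateVariables

section DualFamily

variable {A : Type*} [Ring A] [Algebra ℂ A] {ι : Type*} [Fintype ι]

/-- `e` and `e'` are dual to each other in `D` for the bilinear form `(x, y) ↦ τ(xy)`. -/
structure IsDualFamily (τ : A →ₗ[ℂ] ℂ) (D : Subalgebra ℂ A) (e e' : ι → A) : Prop where
  mem_left : ∀ i, e i ∈ D
  mem_right : ∀ i, e' i ∈ D
  expand_right : ∀ d ∈ D, ∑ i, τ (d * e i) • e' i = d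
  expand_left : ∀ d ∈ D, ∑ i, τ (d * e' i) • e i = d

variable {τ : A →ₗ[ℂ] ℂ} {D : Subalgebra ℂ A} {e e' : ι → A}

theorem IsDualFamily.symm (h : IsDualFamily τ D e e') : IsDualFamily τ D e' e :=
  ⟨h.mem_right, h.mem_left, h.expand_left, h.expand_right⟩

theorem IsDualFamily.sum_conj_mem (h : IsDualFamily τ D e e') (hτ : ∀ x y, τ (x * y) = τ (y * x))
    (x : A) : ∑ i, e' i * x * e i ∈ relativeCommutant D := by
  intro d hd
  calc d * ∑ i, e' i * x * e i
      = ∑ i, ∑ k, τ (d * e' i * e k) • (e' k * x * e i) := by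
        rw [Finset.mul_sum]
        refine Finset.sum_congr rfl fun i _ => ?_
        rw [← mul_assoc, ← mul_assoc]
        conv_lhs => rw [← h.expand_right (d * e' i) (D.mul_mem hd (h.mem_right i))]
        simp [Finset.sum_mul]
    _ = ∑ k, ∑ i, τ (e k * d * e' i) • (e' k * x * e i) := by
        rw [Finset.sum_comm]
        refine Finset.sum_congr rfl fun k _ => Finset.sum_congr rfl fun i _ => ?_
        rw [hτ, ← mul_assoc]
    _ = (∑ i, e' i * x * e i) * d := by
        rw [Finset.sum_mul]
        refine Finset.sum_congr rfl fun k _ => ?_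
        rw [mul_assoc]
        conv_rhs => rw [← h.expand_left (e k * d) (D.mul_mem (h.mem_left k) hd)]
        simp [Finset.mul_sum]

theorem IsDualFamily.condPairing_eq (h : IsDualFamily τ D e e') {E : A →ₗ[ℂ] A}
    (hE : IsCondExp D E) (hEτ : ∀ x, τ (E x) = τ x) (hτ : ∀ x y, τ (x * y) = τ (y * x)) (x y : A) :
    condPairing τ E x y = ∑ i, prodPairing τ (e i * x) (y * e' i) := by
  rw [condPairing_apply]
  conv_lhs => rw [← h.expand_right (E x) (hE.2.1 x)]
  simp only [Finset.sum_mul, map_sum, smul_mul_assoc, map_smul, smul_eq_mul, prodPairing_apply]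
  refine Finset.sum_congr rfl fun i _ => ?_
  rw [← hE.map_mul_right (h.mem_left i), hEτ, hτ x, hτ y]

theorem exists_isDualFamily [FiniteDimensional ℂ D] (hτ : ∀ x y, τ (x * y) = τ (y * x))
    (hD : ∀ d ∈ D, (∀ d' ∈ D, τ (d' * d) = 0) → d = 0) :
    ∃ e e' : Fin (Module.finrank ℂ D) → A, IsDualFamily τ D e e' ∧
      ∀ a : D, LinearMap.trace ℂ D (LinearMap.mulLeft ℂ a) = τ (a * ∑ i, e i * e' i) := by
  set b := Module.finBasis ℂ D
  let F : LinearMap.BilinForm ℂ D :=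
    ((LinearMap.mul ℂ A).compr₂ τ).compl₁₂ D.val.toLinearMap D.val.toLinearMap
  have hF : ∀ x y, F x y = τ ((x : A) * y) := fun _ _ => rfl
  have hsymm : F.IsSymm := ⟨fun x y => by simp [hF, hτ (x : A)]⟩
  have hsep : ∀ x, (∀ y, F y x = 0) → x = 0 :=
    fun x hx => Subtype.ext (hD x x.2 fun d hd => hx ⟨d, hd⟩)
  have hnd : F.Nondegenerate := ⟨fun x hx => hsep x fun y => (hsymm.eq y x).trans (hx y), hsep⟩
  set b' := F.dualBasis hnd b with hb'
  have hr' : ∀ x i, b'.repr x i = τ ((x : A) * b i) := fun x i => by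
    rw [hb', LinearMap.BilinForm.dualBasis_repr_apply, hF]
  have hr : ∀ x i, b.repr x i = τ ((x : A) * b' i) := fun x i => by
    rw [← hF, ← LinearMap.BilinForm.dualBasis_repr_apply hnd b',
      LinearMap.BilinForm.dualBasis_dualBasis hnd hsymm]
  refine ⟨fun i => b i, fun i => b' i, ⟨fun i => (b i).2, fun i => (b' i).2, ?_, ?_⟩, ?_⟩
  · intro d hd
    have := congrArg Subtype.val (b'.sum_repr ⟨d, hd⟩)
    simpa [hr'] using this
  · intro d hd
    have := congrArg Subtype.val (b.sum_repr ⟨d, hd⟩)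
    simpa [hr] using this
  · intro a
    rw [LinearMap.trace_eq_matrix_trace ℂ b, Matrix.trace]
    simp only [Matrix.diag_apply, LinearMap.toMatrix_apply, LinearMap.mulLeft_apply, hr,
      Subalgebra.coe_mul, map_sum, Finset.mul_sum, mul_assoc]

end DualFamily

section FaithfulTrace

variable {A : Type*} [Ring A] [Algebra ℂ A] [StarRing A] {τ : A →ₗ[ℂ] ℂ}

theorem IsFaithfulTracialState.nondegenerate (hτ : IsFaithfulTracialState τ) {D : Subalgebra ℂ A}
    (hD : ∀ d ∈ D, star d ∈ D) : ∀ d ∈ D, (∀ d' ∈ D, τ (d' * d) = 0) → d = 0 :=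
  fun d hd h => hτ.faithful d (h _ (hD d hd))

variable [StarModule ℂ A]

theorem IsFaithfulTracialState.map_star_s15 (hτ : IsFaithfulTracialState τ) (x : A) :
    τ (star x) = star (τ x) := by
  have h0 := (hτ.pos x).2
  have h1 := (hτ.pos (1 + x)).2
  have h2 := (hτ.pos (1 + Complex.I • x)).2
  simp only [star_add, star_one, star_smul, add_mul, mul_add, one_mul, mul_one, map_add,
    smul_mul_assoc, mul_smul_comm, map_smul, hτ.unital, smul_eq_mul, Complex.add_im,
    Complex.mul_im, Complex.star_def, Complex.conj_I, Complex.neg_re, Complex.neg_im, Complex.I_re,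
    Complex.I_im, Complex.one_im, Complex.mul_re, h0] at h1 h2
  apply Complex.ext
  · simp; linarith
  · simp; linarith

theorem MemL2Closure.trace_mul_eq_zero (hτ : IsFaithfulTracialState τ) {S : Set A} {x y : A}
    (hx : MemL2Closure τ S x) (hy : ∀ a ∈ Algebra.adjoin ℂ (S ∪ star '' S), τ (a * y) = 0) :
    τ (x * y) = 0 := by
  set v := τ (x * y) with hv
  set C := (τ (star y * y)).re with hC
  have hC0 : 0 ≤ C := (hτ.pos y).1
  have key : ∀ ε : ℝ, 0 < ε → Complex.normSq v * (1 / (C + 1)) ≤ ε ^ 2 := by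
    intro ε hε
    obtain ⟨a, ha, hdist⟩ := hx ε hε
    set h := x - a with hh
    have hhy : τ (h * y) = v := by rw [hh, sub_mul, map_sub, hy a ha, sub_zero]
    have hle : (τ (h * star h)).re ≤ ε ^ 2 := by
      rw [l2Dist, Real.sqrt_lt' hε] at hdist
      exact hdist.le
    have hyh : τ (star y * star h) = star v := by rw [← star_mul, hτ.map_star_s15, hhy]
    set s : ℝ := 1 / (C + 1) with hs
    have hpos := (hτ.pos (star (h - ((s : ℂ) * v) • star y))).1
    rw [star_star] at hpos
    have hexp : (τ ((h - ((s : ℂ) * v) • star y) * star (h - ((s : ℂ) * v) • star y))).re =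
        (τ (h * star h)).re - 2 * s * Complex.normSq v + s ^ 2 * Complex.normSq v * C := by
      simp only [star_sub, star_smul, star_star, sub_mul, mul_sub, smul_mul_assoc, mul_smul_comm,
        map_sub, map_smul, hhy, hyh, smul_eq_mul]
      simp [Complex.normSq_apply, hC, (hτ.pos y).2]
      ring
    rw [hexp] at hpos
    have hsC : s * (C + 1) = 1 := by rw [hs]; field_simp
    have hs0 : 0 < s := by positivity
    have hN := Complex.normSq_nonneg v
    have : s ^ 2 * Complex.normSq v * C = s * Complex.normSq v - s ^ 2 * Complex.normSq v := by
      linear_combination s * Complex.normSq v * hsC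
    nlinarith [mul_nonneg (sq_nonneg s) hN]
  by_contra hne
  have hvpos : 0 < Complex.normSq v * (1 / (C + 1)) :=
    mul_pos (Complex.normSq_pos.2 hne) (by positivity)
  have := key (Real.sqrt (Complex.normSq v * (1 / (C + 1)) / 2)) (by positivity)
  rw [Real.sq_sqrt (by positivity)] at this
  linarith

end FaithfulTrace

section CommutantProjection

variable {A : Type*} [Ring A] [Algebra ℂ A] {ι : Type*} [Fintype ι]
  {τ : A →ₗ[ℂ] ℂ} {D : Subalgebra ℂ A} {e e' : ι → A}

theorem IsDualFamily.sum_mul_eq (h : IsDualFamily τ D e e') (hτ : ∀ x y, τ (x * y) = τ (y * x))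
    (hD : ∀ d ∈ D, (∀ d' ∈ D, τ (d' * d) = 0) → d = 0) {c : A} (hc : c ∈ D) {N : ℂ}
    (htrace : ∀ d ∈ D, N * τ d = τ (c * d * ∑ i, e i * e' i)) :
    (∑ i, e i * e' i) * c = N • 1 := by
  have hmem : ∑ i, e i * e' i ∈ D :=
    D.sum_mem fun i _ => D.mul_mem (h.mem_left i) (h.mem_right i)
  refine sub_eq_zero.1 (hD _ (D.sub_mem (D.mul_mem hmem hc) (D.smul_mem D.one_mem N)) ?_)
  intro d hd
  rw [mul_sub, map_sub, mul_smul_comm, mul_one, map_smul, smul_eq_mul, htrace d hd, ← mul_assoc,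
    hτ, mul_assoc c, sub_self]

theorem mul_mem_relativeCommutant {x y : A} (hx : x ∈ relativeCommutant D)
    (hy : y ∈ relativeCommutant D) : x * y ∈ relativeCommutant D := by
  intro d hd
  rw [← mul_assoc, hx d hd, mul_assoc, hy d hd, mul_assoc]

variable [StarRing A]

theorem star_mem_relativeCommutant (hD : ∀ d ∈ D, star d ∈ D) {x : A}
    (hx : x ∈ relativeCommutant D) : star x ∈ relativeCommutant D := by
  intro d hd
  have := congrArg star (hx (star d) (hD d hd))
  simpa using this.symm

theorem commutantProjection_eq_zero_iff (hτ : IsFaithfulTracialState τ)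
    (hD : ∀ d ∈ D, star d ∈ D) (h : IsDualFamily τ D e e') {c : A} {N : ℂ} (hN : N ≠ 0)
    (hc : ∀ d ∈ D, c * d = d * c) (hcN : (∑ i, e i * e' i) * c = N • 1)
    (E' : A →ₗ[ℂ] A) (hE'mem : ∀ x, E' x ∈ relativeCommutant D) (hE'τ : ∀ x, τ (E' x) = τ x)
    (hE'bimod : ∀ a ∈ relativeCommutant D, ∀ b ∈ relativeCommutant D, ∀ x,
      E' (a * x * b) = a * E' x * b) (j : A) :
    E' j = 0 ↔ ∑ i, e' i * j * e i = 0 := by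
  have hone : (1 : A) ∈ relativeCommutant D := fun d _ => by simp
  have hcomm : ∀ k ∈ relativeCommutant D, ∀ i, e i * k = k * e i :=
    fun k hk i => hk _ (h.mem_left i)
  have hΩ : ∑ i, e i * e' i ∈ relativeCommutant D := by
    simpa using h.symm.sum_conj_mem hτ.tracial 1
  have hpair : ∀ k ∈ relativeCommutant D,
      τ (k * ∑ i, e' i * j * e i) = τ ((∑ i, e i * e' i) * k * j) := by
    intro k hk
    rw [Finset.mul_sum, Finset.sum_mul, Finset.sum_mul, map_sum, map_sum]
    refine Finset.sum_congr rfl fun i _ => ?_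
    rw [← mul_assoc, hτ.tracial, mul_assoc (e i), hk _ (h.mem_right i)]
    simp only [mul_assoc]
  have hleft : ∀ k ∈ relativeCommutant D, ∀ x, τ (k * E' x) = τ (k * x) := by
    intro k hk x
    rw [← hE'τ (k * x)]
    simpa using congrArg τ (hE'bimod k hk 1 hone x).symm
  constructor
  · intro hj
    apply hτ.faithful
    set z := ∑ i, e' i * j * e i with hz
    have hzs : star z ∈ relativeCommutant D :=
      star_mem_relativeCommutant hD (h.sum_conj_mem hτ.tracial j)
    rw [hpair _ hzs, ← hleft _ (mul_mem_relativeCommutant hΩ hzs), hj, mul_zero, map_zero]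
  · intro hz
    apply hτ.faithful
    have hys := star_mem_relativeCommutant hD (hE'mem j)
    have hcc : c ∈ relativeCommutant D := fun d hd => (hc d hd).symm
    have h0 := hpair _ (mul_mem_relativeCommutant hcc hys)
    rw [hz, mul_zero, map_zero, ← mul_assoc, hcN, smul_mul_assoc, one_mul, smul_mul_assoc,
      map_smul, smul_eq_mul, eq_comm, mul_eq_zero, or_iff_right hN] at h0
    rw [hleft _ hys, h0]

end CommutantProjection

section Density

variable {A : Type*} [Ring A] [Algebra ℂ A] {n : ℕ} {X : Fin n → A} {B : Subalgebra ℂ A}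

theorem map_eq_zero_of_words {S : Set A} (hS : ∀ s ∈ S, s ∈ B ∨ s ∈ Set.range X) (f : A →ₗ[ℂ] ℂ)
    (hf : ∀ l : List (Fin n ⊕ B), f (wordVal (l.map (letter X B))) = 0) :
    ∀ a ∈ Algebra.adjoin ℂ S, f a = 0 := by
  intro a ha
  rw [← Subalgebra.mem_toSubmodule, Algebra.adjoin_eq_span] at ha
  induction ha using Submodule.span_induction with
  | mem a ha =>
    suffices h : ∃ l : List (Fin n ⊕ B), wordVal (l.map (letter X B)) = a by
      obtain ⟨l, rfl⟩ := h
      exact hf l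
    induction ha using Submonoid.closure_induction with
    | mem a ha =>
      rcases hS a ha with hB | ⟨i, rfl⟩
      · exact ⟨[.inr ⟨a, hB⟩], by simp⟩
      · exact ⟨[.inl i], by simp⟩
    | one => exact ⟨[], by simp⟩
    | mul a b _ _ iha ihb =>
      obtain ⟨u, rfl⟩ := iha
      obtain ⟨v, rfl⟩ := ihb
      exact ⟨u ++ v, by simp⟩
  | zero => exact map_zero f
  | add a b _ _ ha hb => rw [map_add, ha, hb, add_zero]
  | smul r a _ ha => rw [map_smul, ha, smul_zero]

variable [StarRing A] [StarModule ℂ A] {τ : A →ₗ[ℂ] ℂ}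

theorem sum_conj_commutator_eq_zero (hτ : IsFaithfulTracialState τ) (hB : ∀ b ∈ B, star b ∈ B)
    (hX : ∀ i, IsSelfAdjoint (X i)) {J : Fin n → A}
    (hJ : ∀ i, MemL2Closure τ ((B : Set A) ∪ Set.range X) (J i)) {ι : Type*} [Fintype ι]
    {e e' : ι → A} (he : ∀ i, e i ∈ B) (he' : ∀ i, e' i ∈ B)
    (h : ∀ l : List (Fin n ⊕ B), τ ((∑ k, e' k * (∑ i, (J i * X i - X i * J i)) * e k) *
      wordVal (l.map (letter X B))) = 0) :
    ∑ k, e' k * (∑ i, (J i * X i - X i * J i)) * e k = 0 := by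
  set q := ∑ k, e' k * (∑ i, (J i * X i - X i * J i)) * e k
  set S : Set A := (B : Set A) ∪ Set.range X
  set T : Set A := S ∪ star '' S
  have hTS : ∀ s ∈ T, s ∈ B ∨ s ∈ Set.range X := by
    rintro s (hs | ⟨s, hs | ⟨i, rfl⟩, rfl⟩)
    · exact hs
    · exact Or.inl (hB s hs)
    · exact Or.inr ⟨i, (hX i).star_eq.symm⟩
  have hBT : ∀ b ∈ B, b ∈ Algebra.adjoin ℂ T :=
    fun b hb => Algebra.subset_adjoin (Or.inl (Or.inl hb))
  have hXT : ∀ i, X i ∈ Algebra.adjoin ℂ T :=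
    fun i => Algebra.subset_adjoin (Or.inl (Or.inr ⟨i, rfl⟩))
  have hstar : ∀ a ∈ Algebra.adjoin ℂ T, star a ∈ Algebra.adjoin ℂ T := by
    intro a ha
    induction ha using Algebra.adjoin_induction with
    | mem a ha =>
      rcases hTS a ha with h | ⟨i, rfl⟩
      · exact hBT _ (hB a h)
      · rw [(hX i).star_eq]
        exact hXT i
    | algebraMap r =>
      rw [← algebraMap_star_comm]
      exact Subalgebra.algebraMap_mem _ _
    | add a b _ _ ha hb =>
      rw [star_add]
      exact Subalgebra.add_mem _ ha hb
    | mul a b _ _ ha hb =>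
      rw [star_mul]
      exact Subalgebra.mul_mem _ hb ha
  have hq0 : ∀ a ∈ Algebra.adjoin ℂ T, τ (q * a) = 0 :=
    map_eq_zero_of_words hTS (τ ∘ₗ LinearMap.mulLeft ℂ q) h
  have hqs : ∀ a ∈ Algebra.adjoin ℂ T, τ (star q * a) = 0 := by
    intro a ha
    have := hτ.map_star_s15 (q * star a)
    rw [hq0 _ (hstar a ha), star_zero, star_mul, star_star] at this
    rw [hτ.tracial, this]
  have hJq : ∀ i, ∀ u ∈ Algebra.adjoin ℂ T, ∀ v ∈ Algebra.adjoin ℂ T,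
      τ (star q * (u * J i * v)) = 0 := by
    intro i u hu v hv
    have := (hJ i).trace_mul_eq_zero hτ (y := v * star q * u) fun a ha => by
      rw [mul_assoc v, ← mul_assoc, hτ.tracial, mul_assoc, hqs]
      exact Subalgebra.mul_mem _ hu (Subalgebra.mul_mem _ ha hv)
    rw [← this, mul_assoc v, ← mul_assoc (J i), hτ.tracial (J i * v)]
    simp only [mul_assoc]
  apply hτ.faithful
  change τ (star q * ∑ k, e' k * (∑ i, (J i * X i - X i * J i)) * e k) = 0
  rw [Finset.mul_sum, map_sum]
  refine Finset.sum_eq_zero fun k _ => ?_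
  rw [Finset.mul_sum, Finset.sum_mul, Finset.mul_sum, map_sum]
  refine Finset.sum_eq_zero fun i _ => ?_
  have h1 := hJq i _ (hBT _ (he' k)) _ (Subalgebra.mul_mem _ (hXT i) (hBT _ (he k)))
  have h2 := hJq i _ (Subalgebra.mul_mem _ (hBT _ (he' k)) (hXT i)) _ (hBT _ (he k))
  rw [mul_sub, sub_mul, mul_sub, map_sub, sub_eq_zero]
  simp only [mul_assoc] at h1 h2 ⊢
  rw [h1, h2]

end Density

theorem commutant_projection_of_commutators_zero_iff_free
    (τ : M →ₗ[ℂ] ℂ) (hτ : IsFaithfulTracialState τ)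
    (D : Subalgebra ℂ M) [FiniteDimensional ℂ ↥D] (hDstar : ∀ d ∈ D, star d ∈ D)
    (ED : M →ₗ[ℂ] M) (hED : IsCondExp D ED) (hEDτ : ∀ x, τ (ED x) = τ x)
    -- `E'` is the trace-preserving conditional expectation `E_{D'}` onto the
    -- relative commutant `D′ ∩ M` (given by `E_{D'}(x) = ∫_U u x u* du`)
    (E' : M →ₗ[ℂ] M)
    (hE'mem : ∀ x, E' x ∈ relativeCommutant D)
    (hE'id : ∀ x ∈ relativeCommutant D, E' x = x)
    (hE'τ : ∀ x, τ (E' x) = τ x)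
    (hE'bimod : ∀ a ∈ relativeCommutant D, ∀ b ∈ relativeCommutant D, ∀ x,
      E' (a * x * b) = a * E' x * b)
    -- `c` is the canonical positive invertible central element of `D`,
    -- `c = (∑ nⱼ²) ∑ⱼ (τ(pⱼ)/nⱼ²) pⱼ`, characterized by
    -- `dim(D) · τ(d) = Tr_D(L_{cd})` for all `d ∈ D`, where `Tr_D` is the
    -- trace of left-multiplication operators on `D`
    (c cInv : M) (hcD : c ∈ D) (hcInvD : cInv ∈ D)
    (hcc : c * cInv = 1) (hcc' : cInv * c = 1)
    (hcstar : star c = c) (hccentral : ∀ d ∈ D, c * d = d * c)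
    (hctrace : ∀ d : ↥D, (Module.finrank ℂ ↥D : ℂ) * τ (d : M) =
      LinearMap.trace ℂ ↥D (LinearMap.mulLeft ℂ ((⟨c, hcD⟩ : ↥D) * d)))
    (B : Subalgebra ℂ M) (hDB : D ≤ B) (hBstar : ∀ b ∈ B, star b ∈ B)
    {n : ℕ} (X : Fin n → M) (hX : ∀ i, IsSelfAdjoint (X i))
    -- `Φ*(X₁,…,Xₙ : B) < ∞`:  a conjugate system `J` exists
    (J : Fin n → M) (hJ : IsConjugateSystem τ B X J) :
    (E' (∑ i, (J i * X i - X i * J i)) = 0 ↔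
      IsFreeWithAmalgamation ED
        ((D ⊔ Algebra.adjoin ℂ (Set.range X) : Subalgebra ℂ M) : Set M)
        (B : Set M)) := by
  have hnd := hτ.nondegenerate hDstar
  obtain ⟨e, e', hdual, htr⟩ := exists_isDualFamily (D := D) hτ.tracial hnd
  have hN : (Module.finrank ℂ D : ℂ) ≠ 0 := by
    intro h0
    have h1 := hctrace 1
    have : Subsingleton D := Module.finrank_zero_iff.1 (by exact_mod_cast h0)
    have h2 : (1 : M) = 0 := congrArg Subtype.val (Subsingleton.elim (1 : D) 0)
    have h3 := hτ.unital
    rw [h2, map_zero] at h3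
    exact zero_ne_one h3
  have hcN := hdual.sum_mul_eq hτ.tracial hnd hcD (N := Module.finrank ℂ D) fun d hd => by
    rw [hctrace ⟨d, hd⟩, htr]
    rfl
  rw [commutantProjection_eq_zero_iff hτ hDstar hdual hN hccentral hcN E' hE'mem hE'τ hE'bimod]
  set j := ∑ i, (J i * X i - X i * J i) with hj
  have hword : ∀ l : List (Fin n ⊕ B),
      τ ((∑ k, e' k * j * e k) * wordVal (l.map (letter X B))) =
        libPairing (condPairing τ ED) 1 (l.map (letter X B)) 1 := by
    intro l
    rw [libPairing_eq_sum _ _ e e' (hdual.condPairing_eq hED hEDτ hτ.tracial), Finset.sum_mul,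
      map_sum]
    refine Finset.sum_congr rfl fun k _ => ?_
    have := hJ.2.sum_commutator_apply hτ.tracial hτ.unital
      (.inr ⟨e k, hDB (hdual.mem_left k)⟩ :: (l ++ [.inr ⟨e' k, hDB (hdual.mem_right k)⟩]))
    rw [List.map_cons, List.map_append, libPairing_cons, libPairing_append] at this
    simp only [letter_inr, List.map_cons, List.map_nil, wordVal_cons, wordVal_append, wordVal_nil,
      libPairing_cons, libPairing_nil, mul_one, one_mul, Bool.false_eq_true, if_false, zero_add,
      add_zero, ← hj] at this ⊢
    rw [← this, mul_assoc, mul_assoc, hτ.tracial]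
    simp only [mul_assoc]
  have hletter : ∀ l : List (Bool × M), (∀ x ∈ l, x.2 ∈ if x.1 then Set.range X else (B : Set M)) →
      ∃ w : List (Fin n ⊕ B), w.map (letter X B) = l := by
    intro l hl
    rw [← Set.mem_range, Set.range_list_map]
    rintro ⟨_ | _, x⟩ hx
    · exact ⟨.inr ⟨x, by simpa using hl _ hx⟩, rfl⟩
    · obtain ⟨i, rfl⟩ : x ∈ Set.range X := by simpa using hl _ hx
      exact ⟨.inl i, rfl⟩
  constructor
  · intro h0
    refine isFreeWithAmalgamation_of_libPairing_eq_zero hED le_sup_left hDB hEDτ hτ.tracial hnd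
      (libPairing_eq_zero_of_generators hED hDB (Set.range X) fun l hl => ?_)
    obtain ⟨w, rfl⟩ := hletter l hl
    rw [← hword, h0, zero_mul, map_zero]
  · intro hfree
    refine sum_conj_commutator_eq_zero hτ hBstar hX hJ.1 (fun k => hDB (hdual.mem_left k))
      (fun k => hDB (hdual.mem_right k)) fun l => ?_
    rw [hword]
    refine libPairing_eq_zero_of_isFreeWithAmalgamation hED le_sup_left hDB hEDτ hfree _ ?_
    intro x hx
    obtain ⟨y, -, rfl⟩ := List.mem_map.1 hx
    rcases y with i | b
    · have : X i ∈ D ⊔ Algebra.adjoin ℂ (Set.range X) :=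
        (le_sup_right : _ ≤ D ⊔ Algebra.adjoin ℂ (Set.range X))
          (Algebra.subset_adjoin ⟨i, rfl⟩)
      simpa using this
    · simp

end OVD
end
end
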